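/- arXiv:1501.04363 — 8 statements merged into one kernel-verified Lean document; each statement's English description precedes it below -/
import Mathlib

section
/- Let (Ω, F, P) be a probability space and let ξ be a nonnegative random variable with ξ < ∞ P-almost surely. Then for every ε > 0 there exists a probability measure P̃ on (Ω, F), equivalent to P and with bounded density dP̃/dP, such that |P̃ − P|_TV ≤ ε and ∫ ξ dP̃ < ∞. -/
open MeasureTheory
open scoped ENNReal

/-- Let `(Ω, F, P)` be a probability space and `ξ` a nonnegative random variable with
`ξ < ∞` `P`-a.s.  Then for every `ε > 0` there exists a probability measure `Q` on `(Ω, F)`,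
equivalent to `P` and with bounded density `dQ/dP`, such that
`|Q − P|_TV = sup_{A ∈ F} |Q(A) − P(A)| ≤ ε` and `∫ ξ dQ < ∞`. -/
theorem stmt_0 {Ω : Type*} [MeasurableSpace Ω] (P : Measure Ω) [IsProbabilityMeasure P]
    (ξ : Ω → ℝ≥0∞) (hξmeas : Measurable ξ) (hξfin : ∀ᵐ ω ∂P, ξ ω < ⊤)
    (ε : ℝ) (hε : 0 < ε) :
    ∃ Q : Measure Ω, IsProbabilityMeasure Q ∧ Q ≪ P ∧ P ≪ Q ∧
      (∃ C : ℝ≥0∞, C ≠ ⊤ ∧ ∀ᵐ ω ∂P, Q.rnDeriv P ω ≤ C) ∧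
      (∀ A : Set Ω, MeasurableSet A → |(Q A).toReal - (P A).toReal| ≤ ε) ∧
      ∫⁻ ω, ξ ω ∂Q < ⊤ := by
  have hδ0 : ENNReal.ofReal ε ≠ 0 := by simpa using hε
  let g : ℕ → Ω → ℝ≥0∞ := fun n ω => (1 + ξ ω * ((n : ℝ≥0∞) + 1)⁻¹)⁻¹
  have hgm : ∀ n, Measurable (g n) := fun n => by
    exact (measurable_const.add (hξmeas.mul_const _)).inv
  have hg1 : ∀ n ω, g n ω ≤ 1 := fun n ω => by
    simp [g]
  have hlim : Filter.Tendsto (fun n => ∫⁻ ω, g n ω ∂P) Filter.atTop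
      (nhds (∫⁻ _, 1 ∂P)) := by
    refine tendsto_lintegral_of_dominated_convergence (fun _ => 1) hgm
      (fun n => Filter.Eventually.of_forall (hg1 n)) (by simp) ?_
    filter_upwards [hξfin] with ω hω
    have h1 : Filter.Tendsto (fun n : ℕ => ((n : ℝ≥0∞) + 1)⁻¹) Filter.atTop (nhds 0) := by
      have := (Filter.tendsto_add_atTop_iff_nat 1).2 ENNReal.tendsto_inv_nat_nhds_zero
      simpa using this
    have h2 := ENNReal.Tendsto.const_mul (a := ξ ω) h1 (Or.inr hω.ne)
    have h3 := (tendsto_const_nhds (x := (1 : ℝ≥0∞))).add h2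
    have h4 := h3.inv
    simpa [g] using h4
  simp only [lintegral_const, measure_univ, mul_one] at hlim
  have hlt : 1 - ENNReal.ofReal ε < 1 := ENNReal.sub_lt_self (by simp) (by simp) hδ0
  obtain ⟨n, hn⟩ := (hlim.eventually (lt_mem_nhds hlt)).exists
  set c := ∫⁻ ω, g n ω ∂P with hc
  have hc0 : c ≠ 0 := (lt_of_le_of_lt zero_le hn).ne'
  have hc1 : c ≤ 1 := by
    calc c ≤ ∫⁻ _, 1 ∂P := lintegral_mono (hg1 n)
      _ = 1 := by simp
  have hct : c ≠ ⊤ := ne_top_of_le_ne_top (by simp) hc1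
  have hci : c⁻¹ ≠ ⊤ := by simpa using hc0
  let f : Ω → ℝ≥0∞ := fun ω => c⁻¹ * g n ω
  have hfm : Measurable f := (hgm n).const_mul _
  have hQp : IsProbabilityMeasure (P.withDensity f) := by
    constructor
    rw [withDensity_apply _ MeasurableSet.univ, Measure.restrict_univ,
      lintegral_const_mul _ (hgm n)]
    exact ENNReal.inv_mul_cancel hc0 hct
  have key : ∀ A : Set Ω, MeasurableSet A →
      P.real A ≤ (P.withDensity f).real A + ε := by
    intro A hA
    have h1 : P A ≤ P.withDensity f A + ENNReal.ofReal ε := by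
      calc P A = ∫⁻ ω in A, (g n ω + (1 - g n ω)) ∂P := by
            simp [add_tsub_cancel_of_le (hg1 n _)]
        _ = ∫⁻ ω in A, g n ω ∂P + ∫⁻ ω in A, (1 - g n ω) ∂P :=
            lintegral_add_left (hgm n) _
        _ ≤ P.withDensity f A + ENNReal.ofReal ε := by
            gcongr
            · rw [withDensity_apply _ hA]
              refine lintegral_mono fun ω => ?_
              exact le_mul_of_one_le_left zero_le (ENNReal.one_le_inv.2 hc1)
            · calc ∫⁻ ω in A, (1 - g n ω) ∂P ≤ ∫⁻ ω, (1 - g n ω) ∂P :=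
                    setLIntegral_le_lintegral _ _
                _ = 1 - c := by
                    rw [lintegral_sub (hgm n) hct (Filter.Eventually.of_forall (hg1 n))]
                    simp [hc]
                _ ≤ ENNReal.ofReal ε := by
                    rw [tsub_le_iff_right, add_comm, ← tsub_le_iff_right]
                    exact hn.le
    have h2 := ENNReal.toReal_mono (by simp) h1
    rwa [ENNReal.toReal_add (by simp) (by simp), ENNReal.toReal_ofReal hε.le] at h2
  refine ⟨P.withDensity f, hQp, withDensity_absolutelyContinuous _ _, ?_, ⟨c⁻¹, hci, ?_⟩, ?_, ?_⟩
  · refine withDensity_absolutelyContinuous' hfm.aemeasurable ?_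
    filter_upwards [hξfin] with ω hω
    have : ξ ω * ((n : ℝ≥0∞) + 1)⁻¹ ≠ ⊤ := ENNReal.mul_ne_top hω.ne (by simp)
    refine mul_ne_zero (by simpa using hct) ?_
    exact ENNReal.inv_ne_zero.2 (ENNReal.add_ne_top.2 ⟨by simp, this⟩)
  · filter_upwards [Measure.rnDeriv_withDensity P hfm] with ω hω
    rw [hω]
    exact mul_le_of_le_one_right zero_le (hg1 n ω)
  · intro A hA
    have h1 := key A hA
    have h2 := key Aᶜ hA.compl
    rw [probReal_compl_eq_one_sub hA, probReal_compl_eq_one_sub hA] at h2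
    change |(P.withDensity f).real A - P.real A| ≤ ε
    rw [abs_le]
    constructor <;> linarith
  · rw [lintegral_withDensity_eq_lintegral_mul _ hfm hξmeas]
    have hb : ∀ ω, (f * ξ) ω ≤ c⁻¹ * ((n : ℝ≥0∞) + 1) := by
      intro ω
      simp only [Pi.mul_apply, f, mul_assoc]
      gcongr
      rw [mul_comm]
      change ξ ω / _ ≤ _
      refine ENNReal.div_le_of_le_mul ?_
      rw [mul_add, mul_comm (ξ ω), ← mul_assoc, ENNReal.mul_inv_cancel (by simp) (by simp), one_mul]
      exact le_add_self
    calc _ ≤ ∫⁻ _, c⁻¹ * ((n : ℝ≥0∞) + 1) ∂P := lintegral_mono hb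
      _ < ⊤ := by
        simp only [lintegral_const, measure_univ, mul_one]
        exact ENNReal.mul_lt_top hci.lt_top (by finiteness)
end

section
/- Let (Ω, F, (F_t)_{t∈[0,T]}, P) be a filtered probability space and let R = (R_t)_{t∈[0,T]} be an adapted process with R_t > 0 a.s. for all t and R_0 = 1, such that both R and 1/R are supermartingales with respect to (F_t) and P. Then for every t ∈ [0,T] one has R_t = 1 almost surely. -/
open MeasureTheory Set

/-- Let `(Ω, F, (F_t)_{t ∈ [0,T]}, P)` be a filtered probability space and `R` an adapted
process indexed by `[0,T]` with `R_t > 0` a.s. and `R_0 = 1`, such that both `R` and `1/R`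
are supermartingales.  Then `R_t = 1` a.s. for every `t ∈ [0,T]`. -/
theorem stmt_1 {Ω : Type*} {m : MeasurableSpace Ω} (P : Measure Ω) [IsProbabilityMeasure P]
    (T : ℝ) (hT : 0 ≤ T) (ℱ : Filtration (Icc (0 : ℝ) T) m)
    (R : Icc (0 : ℝ) T → Ω → ℝ)
    (hpos : ∀ t : Icc (0 : ℝ) T, ∀ᵐ ω ∂P, 0 < R t ω)
    (hone : ∀ᵐ ω ∂P, R ⟨0, left_mem_Icc.mpr hT⟩ ω = 1)
    (hR : Supermartingale R ℱ P)
    (hRinv : Supermartingale (fun t ω => (R t ω)⁻¹) ℱ P) :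
    ∀ t : Icc (0 : ℝ) T, ∀ᵐ ω ∂P, R t ω = 1 := by
  intro t
  have h0 : (⟨0, left_mem_Icc.mpr hT⟩ : Icc (0 : ℝ) T) ≤ t := t.2.1
  have h1 : ∫ ω, R t ω ∂P ≤ 1 := by
    have h := hR.setIntegral_le h0 (s := Set.univ) MeasurableSet.univ
    rw [setIntegral_univ, setIntegral_univ] at h
    refine h.trans (le_of_eq ?_)
    rw [integral_congr_ae (g := fun _ => (1 : ℝ)) hone]
    simp
  have h2 : ∫ ω, (R t ω)⁻¹ ∂P ≤ 1 := by
    have h := hRinv.setIntegral_le h0 (s := Set.univ) MeasurableSet.univ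
    rw [setIntegral_univ, setIntegral_univ] at h
    refine h.trans (le_of_eq ?_)
    rw [integral_congr_ae (g := fun _ => (1 : ℝ)) (by
      filter_upwards [hone] with ω hω
      simp [hω])]
    simp
  have i1 : Integrable (fun ω => R t ω) P := hR.2.2 t
  have i2 : Integrable (fun ω => (R t ω)⁻¹) P := hRinv.2.2 t
  have i3 : Integrable (fun ω => R t ω + (R t ω)⁻¹) P := i1.add i2
  have i4 : Integrable (fun ω => R t ω + (R t ω)⁻¹ - 2) P := i3.sub (integrable_const 2)
  have key : ∀ x : ℝ, 0 < x → x + x⁻¹ - 2 = (x - 1) ^ 2 / x := by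
    intro x hx
    field_simp
    ring
  have hnn : 0 ≤ᵐ[P] fun ω => R t ω + (R t ω)⁻¹ - 2 := by
    filter_upwards [hpos t] with ω hω
    simp only [Pi.zero_apply]
    rw [key _ hω]
    positivity
  have hz : ∫ ω, (R t ω + (R t ω)⁻¹ - 2) ∂P = 0 := by
    apply le_antisymm _ (integral_nonneg_of_ae hnn)
    rw [integral_sub i3 (integrable_const 2), integral_add i1 i2]
    simp
    linarith
  filter_upwards [(integral_eq_zero_iff_of_nonneg_ae hnn i4).1 hz, hpos t] with ω hω hp
  simp only [Pi.zero_apply] at hω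
  rw [key _ hp, div_eq_zero_iff] at hω
  rcases hω with h | h
  · have := pow_eq_zero_iff (two_ne_zero) |>.1 h
    linarith
  · linarith
end

section
/- Let (Ω, F, P) be a probability space, let Z be a random variable with Z > 0 a.s., and let (ξ_i)_{i∈I} be a family of nonnegative random variables such that E[Z ξ_i] ≤ 1 for every i ∈ I. Then the family (ξ_i)_{i∈I} is bounded in probability, i.e., lim_{M→∞} sup_{i∈I} P(ξ_i > M) = 0. -/
open MeasureTheory Filter

/-- Let `(Ω, F, P)` be a probability space, `Z` a random variable with `Z > 0` a.s., and
`(ξ_i)_{i ∈ I}` a family of nonnegative random variables such that `E[Z ξ_i] ≤ 1` for every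
`i ∈ I`.  Then the family `(ξ_i)` is bounded in probability:
`lim_{M → ∞} sup_i P(ξ_i > M) = 0`. -/
theorem stmt_2 {Ω : Type*} [MeasurableSpace Ω] (P : Measure Ω) [IsProbabilityMeasure P]
    {I : Type*} (Z : Ω → ℝ) (hZmeas : Measurable Z) (hZpos : ∀ᵐ ω ∂P, 0 < Z ω)
    (ξ : I → Ω → ℝ) (hξmeas : ∀ i, Measurable (ξ i)) (hξnonneg : ∀ i, ∀ᵐ ω ∂P, 0 ≤ ξ i ω)
    (hbound : ∀ i, ∫⁻ ω, ENNReal.ofReal (Z ω * ξ i ω) ∂P ≤ 1) :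
    Tendsto (fun M : ℝ => ⨆ i, P {ω | M < ξ i ω}) atTop (nhds 0) := by
  have h1 : Tendsto (fun a : ℝ => P {ω | Z ω ≤ a}) (nhdsWithin 0 (Set.Ioi 0)) (nhds 0) := by
    have h := tendsto_measure_biInter_gt (μ := P) (s := fun a : ℝ => {ω | Z ω ≤ a}) (a := 0)
      (fun r _ => (measurableSet_le hZmeas measurable_const).nullMeasurableSet)
      (fun i j _ hij ω hω => le_trans (show Z ω ≤ i from hω) hij)
      ⟨1, one_pos, measure_ne_top _ _⟩
    have h0 : P (⋂ r > (0 : ℝ), {ω | Z ω ≤ r}) = 0 := by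
      refine measure_mono_null ?_ (ae_iff.1 hZpos)
      intro ω hω
      simp only [Set.mem_iInter, Set.mem_setOf_eq] at hω
      exact not_lt.2 (le_of_forall_gt_imp_ge_of_dense hω)
    rw [h0] at h
    exact h
  have hs : Tendsto (fun M : ℝ => √M) atTop atTop := Real.tendsto_sqrt_atTop
  have h2 : Tendsto (fun M : ℝ => P {ω | Z ω ≤ (√M)⁻¹}) atTop (nhds 0) :=
    h1.comp (tendsto_inv_atTop_nhdsGT_zero.comp hs)
  have h3 : Tendsto (fun M : ℝ => (ENNReal.ofReal (√M))⁻¹) atTop (nhds 0) := by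
    have := ENNReal.tendsto_inv_iff.2 (ENNReal.tendsto_ofReal_atTop.comp hs)
    simpa using this
  have h4 := h2.add h3
  rw [add_zero] at h4
  refine tendsto_of_tendsto_of_tendsto_of_le_of_le' tendsto_const_nhds h4
    (Eventually.of_forall fun _ => zero_le) ?_
  filter_upwards [eventually_gt_atTop 0] with M hM
  refine iSup_le fun i => ?_
  have hq : 0 < √M := Real.sqrt_pos.2 hM
  have hmk : P {ω | ENNReal.ofReal (√M) ≤ ENNReal.ofReal (Z ω * ξ i ω)}
      ≤ (ENNReal.ofReal (√M))⁻¹ := by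
    refine (meas_ge_le_lintegral_div
      ((hZmeas.mul (hξmeas i)).ennreal_ofReal.aemeasurable) (by simpa using hq)
      ENNReal.ofReal_ne_top).trans ?_
    rw [← one_div]
    exact ENNReal.div_le_div_right (hbound i) _
  refine le_trans (measure_mono ?_) ((measure_union_le _ _).trans (add_le_add le_rfl hmk))
  intro ω hω
  simp only [Set.mem_setOf_eq] at hω
  by_cases hz : Z ω ≤ (√M)⁻¹
  · exact Or.inl hz
  · right
    push Not at hz
    apply ENNReal.ofReal_le_ofReal
    calc √M = (√M)⁻¹ * M := by
          rw [inv_mul_eq_div, Real.div_sqrt]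
      _ ≤ Z ω * ξ i ω := mul_le_mul hz.le hω.le hM.le ((inv_pos.2 hq).trans hz).le
end

section
/- Let ε ∈ (0, 1/2] and let (ξⁿ)_{n≥1} be nonnegative random variables on a probability space (Ω, F, P) with P(ξⁿ ≥ 1) ≥ 2ε for every n. Then for every n, the Cesàro average ξ̄ⁿ := (1/n) Σ_{i=1}^n ξⁱ satisfies P(ξ̄ⁿ ≥ ε) ≥ ε/(1−ε). Consequently, if ξ̄ⁿ converges almost surely to a random variable ξ, then E[min(ξ, 1)] ≥ ε²/(1−ε) > 0; in particular ξ is not almost surely zero. -/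
open MeasureTheory Filter

/-- Let `ε ∈ (0, 1/2]` and let `(ξⁿ)_{n ≥ 1}` be nonnegative random variables with
`P(ξⁿ ≥ 1) ≥ 2ε` for every `n ≥ 1`.  Then for every `n ≥ 1` the Cesàro average
`ξ̄ⁿ = (1/n) Σ_{i=1}^n ξⁱ` satisfies `P(ξ̄ⁿ ≥ ε) ≥ ε/(1−ε)`.  Consequently, if `ξ̄ⁿ → ξ`
almost surely, then `E[min(ξ,1)] ≥ ε²/(1−ε) > 0`; in particular `ξ` is not a.s. zero. -/
theorem stmt_4 {Ω : Type*} [MeasurableSpace Ω] (P : Measure Ω) [IsProbabilityMeasure P]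
    (ε : ℝ) (hε0 : 0 < ε) (hε1 : ε ≤ 1 / 2)
    (ξ : ℕ → Ω → ℝ) (hmeas : ∀ n, Measurable (ξ n)) (hnonneg : ∀ n ω, 0 ≤ ξ n ω)
    (hlb : ∀ n, 1 ≤ n → ENNReal.ofReal (2 * ε) ≤ P {ω | 1 ≤ ξ n ω}) :
    (∀ n : ℕ, 1 ≤ n →
      ENNReal.ofReal (ε / (1 - ε))
        ≤ P {ω | ε ≤ (1 / (n : ℝ)) * ∑ i ∈ Finset.Icc (1 : ℕ) n, ξ i ω}) ∧
    (∀ ξlim : Ω → ℝ,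
      (∀ᵐ ω ∂P, Tendsto (fun n : ℕ => (1 / (n : ℝ)) * ∑ i ∈ Finset.Icc (1 : ℕ) n, ξ i ω)
        atTop (nhds (ξlim ω))) →
      (0 < ε ^ 2 / (1 - ε) ∧ ε ^ 2 / (1 - ε) ≤ ∫ ω, min (ξlim ω) 1 ∂P ∧
        ¬ (ξlim =ᵐ[P] (0 : Ω → ℝ)))) := by
  have hε2 : 0 < 1 - ε := by linarith
  have hlb' : ∀ n, 1 ≤ n → 2 * ε ≤ P.real {ω | 1 ≤ ξ n ω} := fun n hn =>
    (ENNReal.ofReal_le_iff_le_toReal (measure_ne_top _ _)).1 (hlb n hn)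
  have hmA : ∀ n, MeasurableSet {ω | 1 ≤ ξ n ω} := fun n =>
    measurableSet_le measurable_const (hmeas n)
  have hmavg : ∀ n : ℕ, Measurable
      (fun ω => (1 / (n : ℝ)) * ∑ i ∈ Finset.Icc (1 : ℕ) n, ξ i ω) := fun n =>
    (Finset.measurable_fun_sum _ (fun i _ => hmeas i)).const_mul _
  have hmB : ∀ n : ℕ, MeasurableSet
      {ω | ε ≤ (1 / (n : ℝ)) * ∑ i ∈ Finset.Icc (1 : ℕ) n, ξ i ω} := fun n =>
    measurableSet_le measurable_const (hmavg n)
  have havg0 : ∀ (n : ℕ) ω, 0 ≤ (1 / (n : ℝ)) * ∑ i ∈ Finset.Icc (1 : ℕ) n, ξ i ω :=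
    fun n ω => mul_nonneg (by positivity) (Finset.sum_nonneg fun i _ => hnonneg i ω)
  have key : ∀ n : ℕ, 1 ≤ n → ε / (1 - ε) ≤
      P.real {ω | ε ≤ (1 / (n : ℝ)) * ∑ i ∈ Finset.Icc (1 : ℕ) n, ξ i ω} := by
    intro n hn
    have hn0 : (0 : ℝ) < n := by exact_mod_cast hn
    set B := {ω | ε ≤ (1 / (n : ℝ)) * ∑ i ∈ Finset.Icc (1 : ℕ) n, ξ i ω} with hB
    have hI : ∀ i, Integrable ({ω | 1 ≤ ξ i ω}.indicator (fun _ => (1 : ℝ))) P := fun i =>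
      (integrable_const 1).indicator (hmA i)
    have hIB : Integrable (B.indicator (fun _ => (1 : ℝ))) P :=
      (integrable_const 1).indicator (hmB n)
    have h1 : ∫ ω, ∑ i ∈ Finset.Icc (1 : ℕ) n,
          {ω | 1 ≤ ξ i ω}.indicator (fun _ => (1 : ℝ)) ω ∂P
        = ∑ i ∈ Finset.Icc (1 : ℕ) n, P.real {ω | 1 ≤ ξ i ω} := by
      rw [integral_finsetSum _ (fun i _ => hI i)]
      refine Finset.sum_congr rfl fun i _ => ?_
      rw [integral_indicator (hmA i)]
      simp
    have h2 : ∫ ω, (n : ℝ) * (ε + (1 - ε) * B.indicator (fun _ => (1 : ℝ)) ω) ∂P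
        = n * (ε + (1 - ε) * P.real B) := by
      rw [integral_const_mul, integral_add (integrable_const _) (hIB.const_mul _),
        integral_const_mul, integral_indicator (show MeasurableSet B from hmB n)]
      simp
    have h3 : ∫ ω, ∑ i ∈ Finset.Icc (1 : ℕ) n,
          {ω | 1 ≤ ξ i ω}.indicator (fun _ => (1 : ℝ)) ω ∂P
        ≤ ∫ ω, (n : ℝ) * (ε + (1 - ε) * B.indicator (fun _ => (1 : ℝ)) ω) ∂P := by
      refine integral_mono (integrable_finsetSum _ fun i _ => hI i)
        (((integrable_const _).add (hIB.const_mul _)).const_mul _) fun ω => ?_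
      show ∑ i ∈ Finset.Icc (1 : ℕ) n, {ω | 1 ≤ ξ i ω}.indicator (fun _ => (1 : ℝ)) ω
        ≤ (n : ℝ) * (ε + (1 - ε) * B.indicator (fun _ => (1 : ℝ)) ω)
      by_cases hω : ω ∈ B
      · rw [Set.indicator_of_mem hω]
        calc _ ≤ ∑ i ∈ Finset.Icc (1 : ℕ) n, (1 : ℝ) := by
              refine Finset.sum_le_sum fun i _ => ?_
              exact Set.indicator_le_self' (fun _ _ => zero_le_one) ω
          _ = _ := by simp
      · rw [Set.indicator_of_notMem hω]
        have hlt : (1 / (n : ℝ)) * ∑ i ∈ Finset.Icc (1 : ℕ) n, ξ i ω < ε := not_le.1 hω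
        rw [one_div, inv_mul_lt_iff₀ hn0] at hlt
        calc _ ≤ ∑ i ∈ Finset.Icc (1 : ℕ) n, ξ i ω := by
              refine Finset.sum_le_sum fun i _ => ?_
              by_cases h : ω ∈ {ω | 1 ≤ ξ i ω}
              · rw [Set.indicator_of_mem h]; exact h
              · rw [Set.indicator_of_notMem h]; exact hnonneg i ω
          _ ≤ _ := by simpa using hlt.le
    have h4 : (n : ℝ) * (2 * ε) ≤ ∑ i ∈ Finset.Icc (1 : ℕ) n, P.real {ω | 1 ≤ ξ i ω} := by
      calc (n : ℝ) * (2 * ε) = ∑ i ∈ Finset.Icc (1 : ℕ) n, (2 * ε) := by simp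
        _ ≤ _ := Finset.sum_le_sum fun i hi => hlb' i (Finset.mem_Icc.1 hi).1
    have h5 : (n : ℝ) * (2 * ε) ≤ n * (ε + (1 - ε) * P.real B) := by
      rw [← h2]; exact h4.trans (h1 ▸ h3)
    have h6 := le_of_mul_le_mul_left h5 hn0
    rw [div_le_iff₀ hε2]
    linarith
  refine ⟨fun n hn => (ENNReal.ofReal_le_iff_le_toReal (measure_ne_top _ _)).2 (key n hn), ?_⟩
  intro ξlim hlim
  have hpos : 0 < ε ^ 2 / (1 - ε) := by positivity
  have hmain : ε ^ 2 / (1 - ε) ≤ ∫ ω, min (ξlim ω) 1 ∂P := by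
    have hbd : ∀ (n : ℕ) ω,
        ‖min ((1 / (n : ℝ)) * ∑ i ∈ Finset.Icc (1 : ℕ) n, ξ i ω) 1‖ ≤ 1 := by
      intro n ω
      rw [Real.norm_of_nonneg (le_min (havg0 n ω) zero_le_one)]
      exact min_le_right _ _
    have hms : ∀ n : ℕ, AEStronglyMeasurable
        (fun ω => min ((1 / (n : ℝ)) * ∑ i ∈ Finset.Icc (1 : ℕ) n, ξ i ω) 1) P := fun n =>
      ((hmavg n).min measurable_const).aestronglyMeasurable
    have hT : Tendsto (fun n : ℕ =>
        ∫ ω, min ((1 / (n : ℝ)) * ∑ i ∈ Finset.Icc (1 : ℕ) n, ξ i ω) 1 ∂P) atTop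
        (nhds (∫ ω, min (ξlim ω) 1 ∂P)) := by
      refine tendsto_integral_of_dominated_convergence (fun _ => (1 : ℝ)) hms
        (integrable_const _) (fun n => ae_of_all _ (hbd n)) ?_
      filter_upwards [hlim] with ω hω
      exact hω.min tendsto_const_nhds
    refine ge_of_tendsto hT ?_
    filter_upwards [eventually_ge_atTop 1] with n hn
    have hk := key n hn
    set B := {ω | ε ≤ (1 / (n : ℝ)) * ∑ i ∈ Finset.Icc (1 : ℕ) n, ξ i ω} with hB
    calc ε ^ 2 / (1 - ε) = (ε / (1 - ε)) * ε := by ring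
      _ ≤ P.real B * ε := by gcongr
      _ = ∫ ω, B.indicator (fun _ => ε) ω ∂P := by
        rw [integral_indicator (show MeasurableSet B from hmB n)]; simp
      _ ≤ _ := by
        refine integral_mono ((integrable_const ε).indicator (hmB n))
          ((integrable_const (1 : ℝ)).mono' (hms n) (ae_of_all _ (hbd n))) fun ω => ?_
        show B.indicator (fun _ => ε) ω
          ≤ min ((1 / (n : ℝ)) * ∑ i ∈ Finset.Icc (1 : ℕ) n, ξ i ω) 1
        by_cases hω : ω ∈ B
        · rw [Set.indicator_of_mem hω]; exact le_min hω (by linarith)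
        · rw [Set.indicator_of_notMem hω]; exact le_min (havg0 n ω) zero_le_one
  refine ⟨hpos, hmain, fun h0 => ?_⟩
  have : ∫ ω, min (ξlim ω) 1 ∂P = 0 := by
    rw [integral_congr_ae (g := fun _ => (0 : ℝ))]
    · simp
    · filter_upwards [h0] with ω hω
      simp [hω]
  linarith
end

section
/- Let u, v ∈ D with Ψ(u) > −∞ and Ψ(v) > −∞. Then the function λ ↦ Ψ(u + λ(v−u)) is finite and concave on [0,1], its right derivative ∂Ψ(u; v−u) at λ = 0 exists in (−∞, ∞], and ∂Ψ(u; v−u) ≥ (v−u)·(b − cu) − ∫ (v−u)·x · (u·x)/(1 + u·x) K(dx), where the integral on the right-hand side is well defined with values in [−∞, ∞). -/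
open MeasureTheory Filter Set Matrix
open scoped ENNReal

noncomputable section

variable {d : ℕ}

/-- The Euclidean norm of a vector in `ℝ^d`. -/
def eucNorm (x : Fin d → ℝ) : ℝ := Real.sqrt (x ⬝ᵥ x)

/-- The integrability assumption `∫ (|x| ∧ |x|²) K(dx) < ∞` on the Lévy measure `K`. -/
def LevyIntegrable (K : Measure (Fin d → ℝ)) : Prop :=
  ∫⁻ x, ENNReal.ofReal (min (eucNorm x) (eucNorm x ^ 2)) ∂K ≠ ⊤

/-- The set `D = {v ∈ ℝ^d : v·x > −1 for K-a.e. x}`. -/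
def Dset (K : Measure (Fin d → ℝ)) : Set (Fin d → ℝ) :=
  {v | ∀ᵐ x ∂K, -1 < v ⬝ᵥ x}

/-- The concave function
`Ψ(v) = b·v − (1/2) v·(cv) − ∫ (v·x − log(1 + v·x)) K(dx)`, with values in `[−∞, ∞)`
(on `D` the integrand is nonnegative `K`-a.e.). -/
def Psi (K : Measure (Fin d → ℝ)) (b : Fin d → ℝ) (c : Matrix (Fin d) (Fin d) ℝ)
    (v : Fin d → ℝ) : EReal :=
  ((v ⬝ᵥ b - (1 / 2) * (v ⬝ᵥ (c *ᵥ v)) : ℝ) : EReal)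
    - ((∫⁻ x, ENNReal.ofReal (v ⬝ᵥ x - Real.log (1 + v ⬝ᵥ x)) ∂K : ℝ≥0∞) : EReal)

/-- The null-investment subspace
`N = {v : K(v·x ≠ 0) = 0, cv = 0, v·b = 0}`. -/
def Nset (K : Measure (Fin d → ℝ)) (b : Fin d → ℝ) (c : Matrix (Fin d) (Fin d) ℝ) :
    Set (Fin d → ℝ) :=
  {v | K {x | v ⬝ᵥ x ≠ 0} = 0 ∧ c *ᵥ v = 0 ∧ v ⬝ᵥ b = 0}

/-- The set `I = {v : K(v·x < 0) = 0, cv = 0, v·b ≥ K(v·x)} ∖ N`. -/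
def Iset (K : Measure (Fin d → ℝ)) (b : Fin d → ℝ) (c : Matrix (Fin d) (Fin d) ℝ) :
    Set (Fin d → ℝ) :=
  {v | K {x | v ⬝ᵥ x < 0} = 0 ∧ c *ᵥ v = 0 ∧
      (∫⁻ x, ENNReal.ofReal (v ⬝ᵥ x) ∂K) ≤ ENNReal.ofReal (v ⬝ᵥ b)} \ Nset K b c

/-- `F(v, v⁰) = (v − v⁰)·(b − cv⁰) − ∫ (v − v⁰)·x · (v⁰·x)/(1 + v⁰·x) K(dx)`, as an
extended real number (the integral is split into its positive and negative parts). -/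
def Fval (K : Measure (Fin d → ℝ)) (b : Fin d → ℝ) (c : Matrix (Fin d) (Fin d) ℝ)
    (v v0 : Fin d → ℝ) : EReal :=
  (((v - v0) ⬝ᵥ (b - c *ᵥ v0) : ℝ) : EReal)
    - (((∫⁻ x, ENNReal.ofReal
            (max (((v - v0) ⬝ᵥ x) * ((v0 ⬝ᵥ x) / (1 + v0 ⬝ᵥ x))) 0) ∂K : ℝ≥0∞) : EReal)
      - ((∫⁻ x, ENNReal.ofReal
            (max (-(((v - v0) ⬝ᵥ x) * ((v0 ⬝ᵥ x) / (1 + v0 ⬝ᵥ x)))) 0) ∂K : ℝ≥0∞) : EReal))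

/-- The integrand `a - log (1 + a)`. -/
def ff (a : ℝ) : ℝ := a - Real.log (1 + a)

lemma ff_nonneg {a : ℝ} (ha : -1 < a) : 0 ≤ ff a := by
  have := Real.log_le_sub_one_of_pos (show 0 < 1 + a by linarith)
  unfold ff; linarith

lemma ff_convex {a b s t : ℝ} (ha : -1 < a) (hb : -1 < b) (hs : 0 ≤ s) (ht : 0 ≤ t)
    (hst : s + t = 1) : ff (s * a + t * b) ≤ s * ff a + t * ff b := by
  have h := strictConcaveOn_log_Ioi.concaveOn.2 (show 1 + a ∈ Ioi (0:ℝ) by simp; linarith)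
    (show 1 + b ∈ Ioi (0:ℝ) by simp; linarith) hs ht hst
  simp only [smul_eq_mul] at h
  have e : s * (1 + a) + t * (1 + b) = 1 + (s * a + t * b) := by linear_combination hst
  rw [e] at h
  unfold ff; linarith

lemma ff_grad {a b : ℝ} (ha : -1 < a) (hb : -1 < b) :
    (b - a) * (a / (1 + a)) ≤ ff b - ff a := by
  have ha' : 0 < 1 + a := by linarith
  have hb' : 0 < 1 + b := by linarith
  have h := Real.log_le_sub_one_of_pos (div_pos hb' ha')
  rw [Real.log_div hb'.ne' ha'.ne'] at h
  have e : (b - a) * (a / (1 + a)) = (b - a) - ((1 + b) / (1 + a) - 1) := by field_simp; ring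
  rw [e]; unfold ff; linarith

lemma ff_deriv {a b : ℝ} (ha : -1 < a) :
    HasDerivAt (fun l : ℝ => ff (a + l * (b - a))) ((b - a) * (a / (1 + a))) 0 := by
  have ha' : 0 < 1 + a := by linarith
  have h1 : HasDerivAt (fun l : ℝ => a + l * (b - a)) (b - a) 0 := by
    simpa using ((hasDerivAt_id (0:ℝ)).mul_const (b - a)).const_add a
  have h2 : HasDerivAt (fun l : ℝ => Real.log (1 + (a + l * (b - a)))) ((b - a) / (1 + a)) 0 := by
    have := (h1.const_add 1).log (by simpa using ha'.ne')
    simpa using this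
  have := h1.sub h2
  have e : (b - a) * (a / (1 + a)) = (b - a) - (b - a) / (1 + a) := by field_simp; ring
  rw [e]; exact this

lemma ff_measurable : Measurable ff := by
  unfold ff; fun_prop

lemma gt_conv {a b l : ℝ} (ha : -1 < a) (hb : -1 < b) (h0 : 0 ≤ l) (h1 : l ≤ 1) :
    -1 < a + l * (b - a) := by
  rcases h0.eq_or_lt with rfl | h
  · simpa using ha
  · nlinarith [mul_nonneg (sub_nonneg.2 h1) (by linarith : 0 ≤ a + 1), mul_pos h (by linarith : 0 < b + 1)]

section core
variable {α : Type*} [MeasurableSpace α] {μ : Measure α} {p q : α → ℝ}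

lemma int_conv (hp : Measurable p) (hq : Measurable q) (hp1 : ∀ᵐ x ∂μ, -1 < p x)
    (hq1 : ∀ᵐ x ∂μ, -1 < q x) (ip : Integrable (fun x => ff (p x)) μ)
    (iq : Integrable (fun x => ff (q x)) μ) {l : ℝ} (h0 : 0 ≤ l) (h1 : l ≤ 1) :
    Integrable (fun x => ff (p x + l * (q x - p x))) μ := by
  refine (ip.add iq).mono' (ff_measurable.comp (by fun_prop)).aestronglyMeasurable ?_
  filter_upwards [hp1, hq1] with x hx hy
  rw [Real.norm_eq_abs, abs_of_nonneg (ff_nonneg (gt_conv hx hy h0 h1))]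
  have := ff_convex hx hy (sub_nonneg.2 h1) h0 (by ring)
  rw [show (1 - l) * p x + l * q x = p x + l * (q x - p x) by ring] at this
  have a1 := ff_nonneg hx
  have a2 := ff_nonneg hy
  simp only [Pi.add_apply]
  nlinarith

lemma pos_part_fin (hp1 : ∀ᵐ x ∂μ, -1 < p x)
    (hq1 : ∀ᵐ x ∂μ, -1 < q x) 
    (iq : Integrable (fun x => ff (q x)) μ) :
    ∫⁻ x, ENNReal.ofReal (max ((q x - p x) * (p x / (1 + p x))) 0) ∂μ ≠ ⊤ := by
  refine ne_top_of_le_ne_top iq.lintegral_lt_top.ne (lintegral_mono_ae ?_)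
  filter_upwards [hp1, hq1] with x hx hy
  apply ENNReal.ofReal_le_ofReal
  have := ff_grad hx hy
  have := ff_nonneg hx
  have := ff_nonneg hy
  apply max_le <;> linarith

/-- Fatou step. -/
lemma fatou_core (hp : Measurable p) (hq : Measurable q) (hp1 : ∀ᵐ x ∂μ, -1 < p x)
    (hq1 : ∀ᵐ x ∂μ, -1 < q x) (ip : Integrable (fun x => ff (p x)) μ)
    (iq : Integrable (fun x => ff (q x)) μ) (A B L : ℝ)
    (hL : ∀ l : ℝ, 0 < l → l ≤ 1 →
      A - l * B - ((∫ x, ff (p x + l * (q x - p x)) ∂μ) - ∫ x, ff (p x) ∂μ) / l ≤ L) :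
    Integrable (fun x => (q x - p x) * (p x / (1 + p x))) μ ∧
      A - ∫ x, (q x - p x) * (p x / (1 + p x)) ∂μ ≤ L := by
  set g : α → ℝ := fun x => (q x - p x) * (p x / (1 + p x)) with hg
  set h : α → ℝ := fun x => ff (q x) - ff (p x) with hh
  have ih : Integrable h μ := iq.sub ip
  set G : ℝ → α → ℝ := fun l x => h x - (ff (p x + l * (q x - p x)) - ff (p x)) / l with hG
  have iG : ∀ l : ℝ, 0 < l → l ≤ 1 → Integrable (G l) μ := fun l h0 h1 =>
    ih.sub (((int_conv hp hq hp1 hq1 ip iq h0.le h1).sub ip).div_const l)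
  have eG : ∀ l : ℝ, 0 < l → l ≤ 1 → ∫ x, G l x ∂μ ≤ L - A + l * B + ∫ x, h x ∂μ := by
    intro l h0 h1
    have i1 := int_conv hp hq hp1 hq1 ip iq h0.le h1
    have e : ∫ x, G l x ∂μ = ∫ x, h x ∂μ -
        ((∫ x, ff (p x + l * (q x - p x)) ∂μ) - ∫ x, ff (p x) ∂μ) / l := by
      rw [← integral_sub i1 ip, ← integral_div]
      exact integral_sub ih ((i1.sub ip).div_const l)
    have := hL l h0 h1
    linarith
  have pG : ∀ l : ℝ, 0 < l → l ≤ 1 → 0 ≤ᵐ[μ] G l := by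
    intro l h0 h1
    filter_upwards [hp1, hq1] with x hx hy
    have := ff_convex hx hy (sub_nonneg.2 h1) h0.le (by ring)
    rw [show (1 - l) * p x + l * q x = p x + l * (q x - p x) by ring] at this
    simp only [hG, hh, Pi.zero_apply, sub_nonneg]
    rw [div_le_iff₀ h0]; linarith
  have mg : Measurable g := by fun_prop
  have mh : Measurable h := (ff_measurable.comp hq).sub (ff_measurable.comp hp)
  have mG : ∀ l, Measurable (G l) := by
    intro l
    have : Measurable (fun x => ff (p x + l * (q x - p x))) := ff_measurable.comp (by fun_prop)
    have h2 : Measurable (fun x => ff (p x)) := ff_measurable.comp hp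
    fun_prop
  let r : ℕ → ℝ := fun n => 1 / ((n:ℝ) + 1)
  have r0 : ∀ n, 0 < r n := fun n => by positivity
  have r1 : ∀ n, r n ≤ 1 := fun n => by
    simp only [r]; rw [div_le_one (by positivity)]; linarith [(Nat.cast_nonneg n : (0:ℝ) ≤ n)]
  have rt : Tendsto r atTop (nhds 0) := tendsto_one_div_add_atTop_nhds_zero_nat
  have lim : ∀ᵐ x ∂μ, Tendsto (fun n => G (r n) x) atTop (nhds (h x - g x)) := by
    filter_upwards [hp1] with x hx
    have hd := (ff_deriv (b := q x) hx).tendsto_slope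
    have rt' : Tendsto r atTop (nhdsWithin 0 {0}ᶜ) :=
      tendsto_nhdsWithin_iff.2 ⟨rt, Eventually.of_forall fun n => (r0 n).ne'⟩
    have := (hd.comp rt').const_sub (h x)
    refine this.congr fun n => ?_
    simp [hG, slope_def_field]
  have key : ∫⁻ x, ENNReal.ofReal (h x - g x) ∂μ ≤ ENNReal.ofReal (L - A + ∫ x, h x ∂μ) := by
    calc ∫⁻ x, ENNReal.ofReal (h x - g x) ∂μ
        = ∫⁻ x, liminf (fun n => ENNReal.ofReal (G (r n) x)) atTop ∂μ := by
          apply lintegral_congr_ae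
          filter_upwards [lim] with x hx
          exact (ENNReal.tendsto_ofReal hx).liminf_eq.symm
      _ ≤ liminf (fun n => ∫⁻ x, ENNReal.ofReal (G (r n) x) ∂μ) atTop :=
          lintegral_liminf_le fun n => (mG _).ennreal_ofReal
      _ ≤ liminf (fun n => ENNReal.ofReal (L - A + r n * B + ∫ x, h x ∂μ)) atTop := by
          refine liminf_le_liminf (Eventually.of_forall fun n => ?_)
          show ∫⁻ x, ENNReal.ofReal (G (r n) x) ∂μ ≤ _
          rw [← ofReal_integral_eq_lintegral_ofReal (iG _ (r0 n) (r1 n)) (pG _ (r0 n) (r1 n))]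
          exact ENNReal.ofReal_le_ofReal (eG _ (r0 n) (r1 n))
      _ = ENNReal.ofReal (L - A + ∫ x, h x ∂μ) := by
          apply Tendsto.liminf_eq
          apply ENNReal.tendsto_ofReal
          have := ((rt.mul_const B).const_add (L - A)).add_const (∫ x, h x ∂μ)
          simpa using this
  have pos : 0 ≤ᵐ[μ] fun x => h x - g x := by
    filter_upwards [hp1, hq1] with x hx hy
    exact sub_nonneg.2 (ff_grad hx hy)
  have ihg : Integrable (fun x => h x - g x) μ := by
    refine ⟨(mh.sub mg).aestronglyMeasurable, ?_⟩
    rw [hasFiniteIntegral_iff_ofReal pos]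
    exact key.trans_lt ENNReal.ofReal_lt_top
  have ig : Integrable g μ := by
    have := ih.sub ihg
    refine this.congr (Eventually.of_forall fun x => ?_)
    simp
  refine ⟨ig, ?_⟩
  have n0 : 0 ≤ L - A + ∫ x, h x ∂μ := by
    have hn : ∀ n, 0 ≤ L - A + r n * B + ∫ x, h x ∂μ := fun n =>
      (integral_nonneg_of_ae (pG _ (r0 n) (r1 n))).trans (eG _ (r0 n) (r1 n))
    have := ((rt.mul_const B).const_add (L - A)).add_const (∫ x, h x ∂μ)
    simp only [zero_mul, add_zero] at this
    exact ge_of_tendsto' this hn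
  rw [← ofReal_integral_eq_lintegral_ofReal ihg pos, ENNReal.ofReal_le_ofReal_iff n0,
    integral_sub ih ig] at key
  linarith
end core

lemma quot_lim (φ : ℝ → ℝ)
    (hφ : ∀ l₁ ∈ Icc (0 : ℝ) 1, ∀ l₂ ∈ Icc (0 : ℝ) 1, ∀ θ ∈ Icc (0 : ℝ) 1,
      θ * φ l₁ + (1 - θ) * φ l₂ ≤ φ (θ * l₁ + (1 - θ) * l₂)) :
    ∃ L : EReal, L ≠ ⊥ ∧ Tendsto (fun l : ℝ => (((φ l - φ 0) / l : ℝ) : EReal))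
      (nhdsWithin 0 (Ioi 0)) (nhds L) ∧
      ∀ l : ℝ, 0 < l → l ≤ 1 → (((φ l - φ 0) / l : ℝ) : EReal) ≤ L := by
  set Q : ℝ → EReal := fun l => (((φ l - φ 0) / l : ℝ) : EReal) with hQ
  have anti : ∀ s t : ℝ, 0 < s → s ≤ t → t ≤ 1 → Q t ≤ Q s := by
    intro s t hs hst ht
    have t0 : 0 < t := hs.trans_le hst
    simp only [hQ, EReal.coe_le_coe_iff]
    have := hφ t ⟨t0.le, ht⟩ 0 ⟨le_rfl, zero_le_one⟩ (s / t)
      ⟨by positivity, (div_le_one t0).2 hst⟩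
    rw [mul_zero, add_zero, div_mul_cancel₀ _ t0.ne'] at this
    rw [div_le_div_iff₀ t0 hs]
    have h2 := mul_le_mul_of_nonneg_left this t0.le
    have e : t * (s / t * φ t + (1 - s / t) * φ 0) = s * φ t + (t - s) * φ 0 := by
      field_simp
    rw [e] at h2
    nlinarith
  let L : EReal := ⨆ l : Ioc (0:ℝ) 1, Q l
  have ub : ∀ l : ℝ, 0 < l → l ≤ 1 → Q l ≤ L := fun l h0 h1 =>
    le_iSup (fun l : Ioc (0:ℝ) 1 => Q l) ⟨l, h0, h1⟩
  refine ⟨L, ?_, ?_, ub⟩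
  · intro hb
    have := ub 1 one_pos le_rfl
    rw [hb, le_bot_iff] at this
    exact EReal.coe_ne_bot _ this
  · rw [tendsto_order]
    constructor
    · intro a ha
      obtain ⟨⟨l, h0, h1⟩, hl⟩ := lt_iSup_iff.1 ha
      filter_upwards [Ioo_mem_nhdsGT h0] with s hs
      exact hl.trans_le (anti s l hs.1 hs.2.le h1)
    · intro a ha
      filter_upwards [Ioo_mem_nhdsGT (one_pos : (0:ℝ) < 1)] with s hs
      exact (ub s hs.1 hs.2.le).trans_lt ha

lemma dot_measurable (y : Fin d → ℝ) : Measurable fun x : Fin d → ℝ => y ⬝ᵥ x := by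
  unfold dotProduct; fun_prop

lemma psi_int {K : Measure (Fin d → ℝ)} {b : Fin d → ℝ} {c : Matrix (Fin d) (Fin d) ℝ}
    {y : Fin d → ℝ} (hy : y ∈ Dset K) (h : Psi K b c y ≠ ⊥) :
    Integrable (fun x => ff (y ⬝ᵥ x)) K := by
  refine ⟨(ff_measurable.comp (dot_measurable y)).aestronglyMeasurable, ?_⟩
  rw [hasFiniteIntegral_iff_ofReal]
  · rw [lt_top_iff_ne_top]
    intro ht
    apply h
    unfold Psi
    change _ - ((∫⁻ x, ENNReal.ofReal (ff (y ⬝ᵥ x)) ∂K : ℝ≥0∞) : EReal) = _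
    rw [ht]; simp
  · filter_upwards [hy] with x hx using ff_nonneg hx

lemma psi_eq {K : Measure (Fin d → ℝ)} {b : Fin d → ℝ} {c : Matrix (Fin d) (Fin d) ℝ}
    {y : Fin d → ℝ} (hy : y ∈ Dset K) (h : Integrable (fun x => ff (y ⬝ᵥ x)) K) :
    Psi K b c y = ((y ⬝ᵥ b - (1 / 2) * (y ⬝ᵥ (c *ᵥ y)) - ∫ x, ff (y ⬝ᵥ x) ∂K : ℝ) : EReal) := by
  unfold Psi
  change _ - ((∫⁻ x, ENNReal.ofReal (ff (y ⬝ᵥ x)) ∂K : ℝ≥0∞) : EReal) = _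
  have hp : 0 ≤ᵐ[K] fun x => ff (y ⬝ᵥ x) := by
    filter_upwards [hy] with x hx using ff_nonneg hx
  rw [← ofReal_integral_eq_lintegral_ofReal h hp, EReal.coe_ennreal_ofReal,
    max_eq_left (integral_nonneg_of_ae hp), ← EReal.coe_sub]

lemma dot_line (u v x : Fin d → ℝ) (l : ℝ) :
    (u + l • (v - u)) ⬝ᵥ x = u ⬝ᵥ x + l * (v ⬝ᵥ x - u ⬝ᵥ x) := by
  simp [add_dotProduct, sub_dotProduct, smul_dotProduct]

/-- Let `u, v ∈ D` with `Ψ(u) > −∞` and `Ψ(v) > −∞`.  Then `λ ↦ Ψ(u + λ(v−u))` is finite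
and concave on `[0,1]`, its right derivative `∂Ψ(u; v−u)` at `λ = 0` exists in `(−∞, ∞]`,
and `∂Ψ(u; v−u) ≥ (v−u)·(b − cu) − ∫ (v−u)·x (u·x)/(1 + u·x) K(dx)`, the integral on the
right-hand side being well defined with values in `[−∞, ∞)` (its positive part is finite). -/
theorem stmt_8 (hd : 1 ≤ d) (K : Measure (Fin d → ℝ)) (hK0 : K {0} = 0)
    (hKint : LevyIntegrable K) (b : Fin d → ℝ) (c : Matrix (Fin d) (Fin d) ℝ)
    (hc : c.PosSemidef) (u v : Fin d → ℝ) (hu : u ∈ Dset K) (hv : v ∈ Dset K)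
    (hPsiu : Psi K b c u ≠ ⊥) (hPsiv : Psi K b c v ≠ ⊥) :
    (∀ lam ∈ Icc (0 : ℝ) 1,
      Psi K b c (u + lam • (v - u)) ≠ ⊥ ∧ Psi K b c (u + lam • (v - u)) ≠ ⊤) ∧
    (∀ l₁ ∈ Icc (0 : ℝ) 1, ∀ l₂ ∈ Icc (0 : ℝ) 1, ∀ θ ∈ Icc (0 : ℝ) 1,
      θ * (Psi K b c (u + l₁ • (v - u))).toReal
          + (1 - θ) * (Psi K b c (u + l₂ • (v - u))).toReal
        ≤ (Psi K b c (u + (θ * l₁ + (1 - θ) * l₂) • (v - u))).toReal) ∧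
    (∫⁻ x, ENNReal.ofReal (max (((v - u) ⬝ᵥ x) * ((u ⬝ᵥ x) / (1 + u ⬝ᵥ x))) 0) ∂K ≠ ⊤) ∧
    (∃ L : EReal, L ≠ ⊥ ∧
      Tendsto (fun lam : ℝ =>
          ((((Psi K b c (u + lam • (v - u))).toReal - (Psi K b c u).toReal) / lam : ℝ) :
            EReal))
        (nhdsWithin 0 (Ioi 0)) (nhds L) ∧
      Fval K b c v u ≤ L) := by
  have iu := psi_int hu hPsiu
  have iv := psi_int hv hPsiv
  have mu := dot_measurable u
  have mv := dot_measurable v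
  have hu' : ∀ᵐ x ∂K, -1 < u ⬝ᵥ x := hu
  have hv' : ∀ᵐ x ∂K, -1 < v ⬝ᵥ x := hv
  have il : ∀ l ∈ Icc (0:ℝ) 1,
      Integrable (fun x => ff (u ⬝ᵥ x + l * (v ⬝ᵥ x - u ⬝ᵥ x))) K := fun l hl =>
    int_conv mu mv hu' hv' iu iv hl.1 hl.2
  set A : ℝ := (v - u) ⬝ᵥ (b - c *ᵥ u) with hA
  set B : ℝ := (v - u) ⬝ᵥ (c *ᵥ (v - u)) with hB
  have hB0 : 0 ≤ B := by
    have := hc.dotProduct_mulVec_nonneg (v - u)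
    simpa only [star_trivial] using this
  have hsym : u ⬝ᵥ (c *ᵥ (v - u)) = (v - u) ⬝ᵥ (c *ᵥ u) := by
    have ht : cᵀ = c := by have := hc.isHermitian.eq; rwa [conjTranspose_eq_transpose_of_trivial] at this
    rw [dotProduct_mulVec, ← mulVec_transpose, ht, dotProduct_comm]
  set C : ℝ := u ⬝ᵥ b - (1 / 2) * (u ⬝ᵥ (c *ᵥ u)) with hC
  have ePsi : ∀ l ∈ Icc (0:ℝ) 1, Psi K b c (u + l • (v - u)) =
      ((C + l * A - l ^ 2 * (B / 2) - ∫ x, ff (u ⬝ᵥ x + l * (v ⬝ᵥ x - u ⬝ᵥ x)) ∂K : ℝ) : EReal) := by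
    intro l hl
    have hD : u + l • (v - u) ∈ Dset K := by
      show ∀ᵐ x ∂K, _
      filter_upwards [hu', hv'] with x hx hy
      rw [dot_line]; exact gt_conv hx hy hl.1 hl.2
    rw [psi_eq hD (by simpa only [dot_line] using il l hl)]
    have e0 : ∫ x, ff ((u + l • (v - u)) ⬝ᵥ x) ∂K =
        ∫ x, ff (u ⬝ᵥ x + l * (v ⬝ᵥ x - u ⬝ᵥ x)) ∂K := by simp only [dot_line]
    rw [e0, dot_line u v b l]
    congr 2
    have e : (u + l • (v - u)) ⬝ᵥ (c *ᵥ (u + l • (v - u))) =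
        u ⬝ᵥ (c *ᵥ u) + 2 * l * ((v - u) ⬝ᵥ (c *ᵥ u)) + l ^ 2 * B := by
      rw [mulVec_add, mulVec_smul, add_dotProduct, dotProduct_add, dotProduct_add,
        smul_dotProduct, smul_dotProduct, dotProduct_smul, dotProduct_smul, hsym, ← hB]
      simp only [smul_eq_mul]; ring
    rw [e, hA, hC, dotProduct_sub, sub_dotProduct v u b]
    ring
  set φ : ℝ → ℝ := fun l => (Psi K b c (u + l • (v - u))).toReal with hφ
  have eφ : ∀ l ∈ Icc (0:ℝ) 1, φ l =
      C + l * A - l ^ 2 * (B / 2) - ∫ x, ff (u ⬝ᵥ x + l * (v ⬝ᵥ x - u ⬝ᵥ x)) ∂K := by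
    intro l hl
    simp only [hφ]; rw [ePsi l hl, EReal.toReal_coe]
  have conc : ∀ l₁ ∈ Icc (0 : ℝ) 1, ∀ l₂ ∈ Icc (0 : ℝ) 1, ∀ θ ∈ Icc (0 : ℝ) 1,
      θ * φ l₁ + (1 - θ) * φ l₂ ≤ φ (θ * l₁ + (1 - θ) * l₂) := by
    intro l₁ h₁ l₂ h₂ θ hθ
    have h1θ : 0 ≤ 1 - θ := sub_nonneg.2 hθ.2
    have h₃ : θ * l₁ + (1 - θ) * l₂ ∈ Icc (0:ℝ) 1 :=
      (convex_Icc (0:ℝ) 1) h₁ h₂ hθ.1 h1θ (by ring)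
    rw [eφ _ h₁, eφ _ h₂, eφ _ h₃]
    have hI : ∫ x, ff (u ⬝ᵥ x + (θ * l₁ + (1 - θ) * l₂) * (v ⬝ᵥ x - u ⬝ᵥ x)) ∂K ≤
        θ * (∫ x, ff (u ⬝ᵥ x + l₁ * (v ⬝ᵥ x - u ⬝ᵥ x)) ∂K) +
        (1 - θ) * (∫ x, ff (u ⬝ᵥ x + l₂ * (v ⬝ᵥ x - u ⬝ᵥ x)) ∂K) := by
      rw [← integral_const_mul, ← integral_const_mul,
        ← integral_add ((il _ h₁).const_mul _) ((il _ h₂).const_mul _)]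
      refine integral_mono_ae (il _ h₃) (((il _ h₁).const_mul _).add ((il _ h₂).const_mul _)) ?_
      filter_upwards [hu', hv'] with x hx hy
      have := ff_convex (gt_conv hx hy h₁.1 h₁.2) (gt_conv hx hy h₂.1 h₂.2) hθ.1 h1θ (by ring)
      rwa [show θ * (u ⬝ᵥ x + l₁ * (v ⬝ᵥ x - u ⬝ᵥ x)) +
        (1 - θ) * (u ⬝ᵥ x + l₂ * (v ⬝ᵥ x - u ⬝ᵥ x)) =
        u ⬝ᵥ x + (θ * l₁ + (1 - θ) * l₂) * (v ⬝ᵥ x - u ⬝ᵥ x) by ring] at this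
    have hq : (θ * l₁ + (1 - θ) * l₂) ^ 2 * (B / 2) ≤
        (θ * l₁ ^ 2 + (1 - θ) * l₂ ^ 2) * (B / 2) := by
      apply mul_le_mul_of_nonneg_right _ (by positivity)
      nlinarith [mul_nonneg (mul_nonneg hθ.1 h1θ) (sq_nonneg (l₁ - l₂))]
    linarith
  have hpos := pos_part_fin (μ := K) (p := fun x => u ⬝ᵥ x) (q := fun x => v ⬝ᵥ x) hu' hv' iv
  have hpos' : ∫⁻ x, ENNReal.ofReal
      (max (((v - u) ⬝ᵥ x) * ((u ⬝ᵥ x) / (1 + u ⬝ᵥ x))) 0) ∂K ≠ ⊤ := by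
    simpa only [sub_dotProduct] using hpos
  refine ⟨fun l hl => ?_, conc, hpos', ?_⟩
  · rw [ePsi l hl]; exact ⟨EReal.coe_ne_bot _, EReal.coe_ne_top _⟩
  obtain ⟨L, hLb, hLt, hLu⟩ := quot_lim φ conc
  have φ0 : φ 0 = (Psi K b c u).toReal := by simp [hφ]
  refine ⟨L, hLb, by rw [← φ0]; exact hLt, ?_⟩
  induction L with
  | bot => exact absurd rfl hLb
  | top => exact le_top
  | coe L =>
    obtain ⟨ig, hle⟩ := fatou_core (μ := K) mu mv hu' hv' iu iv A (B / 2) L (by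
      intro l h0 h1
      have := hLu l h0 h1
      rw [EReal.coe_le_coe_iff, eφ l ⟨h0.le, h1⟩, eφ 0 ⟨le_rfl, zero_le_one⟩] at this
      convert this using 1
      simp only [zero_mul, add_zero]
      field_simp
      ring)
    simp only [← sub_dotProduct] at ig hle
    rw [integral_eq_lintegral_pos_part_sub_lintegral_neg_part ig] at hle
    have em : ∀ a : ℝ, ENNReal.ofReal (max a 0) = ENNReal.ofReal a := fun a => by
      simp [ENNReal.ofReal_max]
    have hN : ∫⁻ x, ENNReal.ofReal (-(((v - u) ⬝ᵥ x) * ((u ⬝ᵥ x) / (1 + u ⬝ᵥ x)))) ∂K ≠ ⊤ :=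
      ig.neg.lintegral_lt_top.ne
    have hP := ig.lintegral_lt_top.ne
    unfold Fval
    simp only [em]
    rw [← ENNReal.ofReal_toReal hN, ← ENNReal.ofReal_toReal hP, EReal.coe_ennreal_ofReal,
      EReal.coe_ennreal_ofReal, max_eq_left ENNReal.toReal_nonneg,
      max_eq_left ENNReal.toReal_nonneg, ← EReal.coe_sub, ← EReal.coe_sub, EReal.coe_le_coe_iff]
    exact hle
end
end

section
/- Suppose I = ∅. Then sup_{v∈D} Ψ(v) < ∞ and there exists a unique v⁰ ∈ D ∩ N^⊥ with Ψ(v⁰) = sup_{v∈D} Ψ(v). Moreover, for any point v⁰ ∈ D at which the supremum of Ψ over D is attained, one has F(v, v⁰) ≤ 0 for every v ∈ D. -/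
open MeasureTheory Filter Set Matrix
open scoped ENNReal

noncomputable section

variable {d : ℕ}

/-- The orthogonal complement `N^⊥` of the null-investment subspace `N`. -/
def Nperp (K : Measure (Fin d → ℝ)) (b : Fin d → ℝ) (c : Matrix (Fin d) (Fin d) ℝ) :
    Set (Fin d → ℝ) :=
  {w | ∀ u ∈ Nset K b c, w ⬝ᵥ u = 0}

namespace Aux
open Topology

def hE (y : ℝ) : ℝ≥0∞ := ⨆ a : {a : ℝ // 0 < a}, ENNReal.ofReal (y - (1 + y) / a.1 + 1 - Real.log a.1)

lemma hE_lsc : LowerSemicontinuous hE := by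
  apply lowerSemicontinuous_iSup
  intro a
  apply Continuous.lowerSemicontinuous
  exact ENNReal.continuous_ofReal.comp (by fun_prop)

lemma hE_of_gt {y : ℝ} (hy : -1 < y) : hE y = ENNReal.ofReal (y - Real.log (1 + y)) := by
  have hy' : 0 < 1 + y := by linarith
  apply le_antisymm
  · apply iSup_le
    rintro ⟨a, ha⟩
    apply ENNReal.ofReal_le_ofReal
    have := Real.log_le_sub_one_of_pos (div_pos hy' ha)
    rw [Real.log_div hy'.ne' ha.ne'] at this
    simp only
    linarith
  · refine le_trans ?_ (le_iSup _ (⟨1 + y, hy'⟩ : {a : ℝ // 0 < a}))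
    apply ENNReal.ofReal_le_ofReal
    simp only
    rw [div_self hy'.ne']
    linarith

lemma hE_of_le {y : ℝ} (hy : y ≤ -1) : hE y = ⊤ := by
  apply ENNReal.eq_top_of_forall_nnreal_le
  intro r
  refine le_trans ?_ (le_iSup _ (⟨Real.exp (-(r - 1 - y)), Real.exp_pos _⟩ : {a : ℝ // 0 < a}))
  rw [← ENNReal.ofReal_coe_nnreal]
  apply ENNReal.ofReal_le_ofReal
  simp only [Real.log_exp]
  have : (1 + y) / Real.exp (-(r - 1 - y)) ≤ 0 :=
    div_nonpos_of_nonpos_of_nonneg (by linarith) (Real.exp_pos _).le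
  linarith

lemma hE_mul {s y : ℝ} (hs : 0 ≤ s) (hs1 : s ≤ 1) : hE (s * y) ≤ ENNReal.ofReal s * hE y := by
  rcases hs.eq_or_lt with rfl | hs
  · rw [zero_mul, hE_of_gt (by norm_num)]; simp
  apply iSup_le
  rintro ⟨a, ha⟩
  rcases le_or_gt y (-1) with hy | hy
  · rw [hE_of_le hy, ENNReal.mul_top (by simpa using hs)]; exact le_top
  rw [hE_of_gt hy, ← ENNReal.ofReal_mul hs.le]
  apply ENNReal.ofReal_le_ofReal
  simp only
  have h1 : 0 < 1 + y := by linarith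
  have h2 : 0 < 1 + s * y := by nlinarith
  have h3 := Real.log_le_sub_one_of_pos (div_pos h2 ha)
  rw [Real.log_div h2.ne' ha.ne'] at h3
  have h4 := strictConcaveOn_log_Ioi.concaveOn.2 (show (1 + y) ∈ Ioi (0:ℝ) from h1)
    (show (1:ℝ) ∈ Ioi (0:ℝ) by simp) hs.le (by linarith : 0 ≤ 1 - s) (by ring)
  simp only [smul_eq_mul, Real.log_one, mul_zero, add_zero] at h4
  rw [show s * (1 + y) + (1 - s) * 1 = 1 + s * y by ring] at h4
  linarith

def J (K : Measure (Fin d → ℝ)) (v : Fin d → ℝ) : ℝ≥0∞ := ∫⁻ x, hE (v ⬝ᵥ x) ∂K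

def q (b : Fin d → ℝ) (c : Matrix (Fin d) (Fin d) ℝ) (v : Fin d → ℝ) : ℝ :=
  v ⬝ᵥ b - (1 / 2) * (v ⬝ᵥ (c *ᵥ v))

lemma hE_dot_meas (v : Fin d → ℝ) : Measurable fun x => hE (v ⬝ᵥ x) :=
  hE_lsc.measurable.comp (by fun_prop)

lemma q_cont (b : Fin d → ℝ) (c : Matrix (Fin d) (Fin d) ℝ) : Continuous (q b c) := by
  unfold q; fun_prop

lemma J_lsc (K : Measure (Fin d → ℝ)) : LowerSemicontinuous (J K) := by
  rw [lowerSemicontinuous_iff_le_liminf]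
  intro v
  refine le_trans ?_ (lintegral_liminf_le (fun w => hE_dot_meas w))
  apply lintegral_mono
  intro x
  have : LowerSemicontinuous fun w : Fin d → ℝ => hE (w ⬝ᵥ x) :=
    hE_lsc.comp (by fun_prop : Continuous fun w : Fin d → ℝ => w ⬝ᵥ x)
  exact this.le_liminf v

lemma J_of_D {K : Measure (Fin d → ℝ)} {v : Fin d → ℝ} (hv : v ∈ Dset K) :
    J K v = ∫⁻ x, ENNReal.ofReal (v ⬝ᵥ x - Real.log (1 + v ⬝ᵥ x)) ∂K := by
  apply lintegral_congr_ae
  filter_upwards [hv] with x hx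
  exact hE_of_gt hx

lemma D_of_J {K : Measure (Fin d → ℝ)} {v : Fin d → ℝ} (hv : J K v ≠ ⊤) : v ∈ Dset K := by
  have := ae_lt_top (hE_dot_meas v) hv
  show ∀ᵐ x ∂K, _
  filter_upwards [this] with x hx
  by_contra h
  rw [hE_of_le (not_lt.1 h)] at hx
  exact lt_irrefl _ hx

lemma Psi_eq {K : Measure (Fin d → ℝ)} {b : Fin d → ℝ} {c : Matrix (Fin d) (Fin d) ℝ}
    {v : Fin d → ℝ} (hv : v ∈ Dset K) :
    Psi K b c v = (q b c v : EReal) - (J K v : EReal) := by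
  rw [J_of_D hv]; rfl

lemma Psi_eq_real {K : Measure (Fin d → ℝ)} {b : Fin d → ℝ} {c : Matrix (Fin d) (Fin d) ℝ}
    {v : Fin d → ℝ} (hv : J K v ≠ ⊤) :
    Psi K b c v = ((q b c v - (J K v).toReal : ℝ) : EReal) := by
  rw [Psi_eq (D_of_J hv), EReal.coe_sub, EReal.coe_ennreal_toReal hv]

lemma Psi_bot {K : Measure (Fin d → ℝ)} {b : Fin d → ℝ} {c : Matrix (Fin d) (Fin d) ℝ}
    {v : Fin d → ℝ} (hD : v ∈ Dset K) (hv : J K v = ⊤) :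
    Psi K b c v = ⊥ := by
  rw [Psi_eq hD, hv]; simp

lemma J_zero (K : Measure (Fin d → ℝ)) : J K 0 = 0 := by
  simp [J, hE_of_gt]

lemma zero_mem_D (K : Measure (Fin d → ℝ)) : 0 ∈ Dset K := D_of_J (by simp [J_zero])

lemma Psi_zero (K : Measure (Fin d → ℝ)) (b : Fin d → ℝ) (c : Matrix (Fin d) (Fin d) ℝ) :
    Psi K b c 0 = 0 := by
  rw [Psi_eq_real (by simp [J_zero])]; simp [J_zero, q]

lemma J_ne_top_of_max {K : Measure (Fin d → ℝ)} {b : Fin d → ℝ} {c : Matrix (Fin d) (Fin d) ℝ}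
    {v : Fin d → ℝ} (hD : v ∈ Dset K) (h : ∀ w ∈ Dset K, Psi K b c w ≤ Psi K b c v) :
    J K v ≠ ⊤ := by
  intro ht
  have := h 0 (zero_mem_D K)
  rw [Psi_bot hD ht, Psi_zero] at this
  simp at this

lemma le_of_Psi {K : Measure (Fin d → ℝ)} {b : Fin d → ℝ} {c : Matrix (Fin d) (Fin d) ℝ}
    {v w : Fin d → ℝ} (hv : J K v ≠ ⊤) (hw : J K w ≠ ⊤) (h : Psi K b c w ≤ Psi K b c v) :
    q b c w - (J K w).toReal ≤ q b c v - (J K v).toReal := by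
  rw [Psi_eq_real hv, Psi_eq_real hw] at h
  exact_mod_cast h

lemma c_nonneg {c : Matrix (Fin d) (Fin d) ℝ} (hc : c.PosSemidef) (v : Fin d → ℝ) :
    0 ≤ v ⬝ᵥ (c *ᵥ v) := by simpa using hc.dotProduct_mulVec_nonneg v

lemma c_zero {c : Matrix (Fin d) (Fin d) ℝ} (hc : c.PosSemidef) {v : Fin d → ℝ}
    (h : v ⬝ᵥ (c *ᵥ v) = 0) : c *ᵥ v = 0 := by
  rw [← hc.dotProduct_mulVec_zero_iff]; simpa using h

lemma c_symm {c : Matrix (Fin d) (Fin d) ℝ} (hc : c.PosSemidef) (v w : Fin d → ℝ) :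
    v ⬝ᵥ (c *ᵥ w) = w ⬝ᵥ (c *ᵥ v) := by
  have h : cᵀ = c := by simpa using hc.isHermitian.eq
  rw [dotProduct_mulVec, ← mulVec_transpose, h, dotProduct_comm]

/-- the superlevel set -/
def S (K : Measure (Fin d → ℝ)) (b : Fin d → ℝ) (c : Matrix (Fin d) (Fin d) ℝ) :
    Set (Fin d → ℝ) :=
  {v | v ∈ Nperp K b c ∧ 0 ≤ q b c v ∧ J K v ≤ ENNReal.ofReal (q b c v)}

lemma S_closed (K : Measure (Fin d → ℝ)) (b : Fin d → ℝ) (c : Matrix (Fin d) (Fin d) ℝ) :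
    IsClosed (S K b c) := by
  refine IsClosed.inter ?_ (IsClosed.inter ?_ ?_)
  · have : Nperp K b c = ⋂ u ∈ Nset K b c, {w | w ⬝ᵥ u = 0} := by
      ext w; simp [Nperp]
    change IsClosed (Nperp K b c)
    rw [this]
    refine isClosed_biInter fun u _ => isClosed_eq (by fun_prop) (by fun_prop)
  · exact isClosed_le continuous_const (q_cont b c)
  · exact (J_lsc K).isClosed_epigraph.preimage
      (continuous_id.prodMk (ENNReal.continuous_ofReal.comp (q_cont b c)))

lemma S_zero (K : Measure (Fin d → ℝ)) (b : Fin d → ℝ) (c : Matrix (Fin d) (Fin d) ℝ) :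
    0 ∈ S K b c := by
  refine ⟨fun u _ => by simp, by simp [q], by simp [J_zero]⟩

lemma S_star {K : Measure (Fin d → ℝ)} {b : Fin d → ℝ} {c : Matrix (Fin d) (Fin d) ℝ}
    (hc : c.PosSemidef) {v : Fin d → ℝ} (hv : v ∈ S K b c) {s : ℝ} (hs : 0 ≤ s) (hs1 : s ≤ 1) :
    s • v ∈ S K b c := by
  obtain ⟨h1, h2, h3⟩ := hv
  have hq : s * q b c v ≤ q b c (s • v) := by
    have := c_nonneg hc v
    simp only [q, smul_dotProduct, mulVec_smul, dotProduct_smul, smul_eq_mul]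
    nlinarith [mul_nonneg (mul_nonneg hs (sub_nonneg.2 hs1)) this]
  refine ⟨fun u hu => by rw [smul_dotProduct, h1 u hu, smul_zero],
    (mul_nonneg hs h2).trans hq, ?_⟩
  calc J K (s • v) ≤ ∫⁻ x, ENNReal.ofReal s * hE (v ⬝ᵥ x) ∂K := by
        apply lintegral_mono
        intro x
        simp only [smul_dotProduct, smul_eq_mul]
        exact hE_mul hs hs1
    _ = ENNReal.ofReal s * J K v := lintegral_const_mul _ (hE_dot_meas v)
    _ ≤ ENNReal.ofReal s * ENNReal.ofReal (q b c v) := by gcongr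
    _ = ENNReal.ofReal (s * q b c v) := (ENNReal.ofReal_mul hs).symm
    _ ≤ _ := ENNReal.ofReal_le_ofReal hq

lemma log_lim {y : ℝ} (hy : 0 ≤ y) :
    Tendsto (fun n : ℕ => ((n + 1 : ℝ) * y - Real.log (1 + (n + 1 : ℝ) * y)) / (n + 1)) atTop (𝓝 y) := by
  rcases hy.eq_or_lt with rfl | hy
  · simp
  have h := Real.tendsto_pow_log_div_mul_add_atTop (1 / y) (-(1 / y)) 1 (by positivity)
  have h2 : Tendsto (fun n : ℕ => 1 + ((n:ℝ) + 1) * y) atTop atTop := by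
    apply tendsto_atTop_add_const_left
    apply Tendsto.atTop_mul_const hy
    exact tendsto_atTop_add_const_right _ _ tendsto_natCast_atTop_atTop
  have h3 := (h.comp h2).const_sub y
  rw [sub_zero] at h3
  refine h3.congr fun n => ?_
  have : (n : ℝ) + 1 ≠ 0 := by positivity
  simp only [Function.comp, pow_one]
  rw [show 1 / y * (1 + ((n:ℝ) + 1) * y) + -(1 / y) = n + 1 by field_simp; ring]
  field_simp

lemma ray {K : Measure (Fin d → ℝ)} {b : Fin d → ℝ} {c : Matrix (Fin d) (Fin d) ℝ}
    (hc : c.PosSemidef) (hI : Iset K b c = ∅) {u : Fin d → ℝ}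
    (hu : ∀ t : ℝ, 0 ≤ t → t • u ∈ S K b c) : u = 0 := by
  have hperp : u ∈ Nperp K b c := by simpa using (hu 1 zero_le_one).1
  have hq : ∀ t, q b c (t • u) = t * (u ⬝ᵥ b) - 1 / 2 * t ^ 2 * (u ⬝ᵥ (c *ᵥ u)) := by
    intro t
    simp only [q, smul_dotProduct, mulVec_smul, dotProduct_smul, smul_eq_mul]; ring
  have hcu : u ⬝ᵥ (c *ᵥ u) = 0 := by
    by_contra hne
    have hpos : 0 < u ⬝ᵥ (c *ᵥ u) := lt_of_le_of_ne (c_nonneg hc u) (Ne.symm hne)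
    set A := u ⬝ᵥ (c *ᵥ u)
    set B := u ⬝ᵥ b
    have h := (hu (2 * (|B| + 1) / A) (by positivity)).2.1
    rw [hq] at h
    have : 2 * (|B| + 1) / A * B - 1 / 2 * (2 * (|B| + 1) / A) ^ 2 * A
      = 2 * (|B| + 1) / A * (B - (|B| + 1)) := by field_simp
    rw [this] at h
    have h1 : B - (|B| + 1) < 0 := by linarith [le_abs_self B]
    have h2 : 0 < 2 * (|B| + 1) / A := by positivity
    nlinarith
  have hcu' := c_zero hc hcu
  have hJ : ∀ t : ℝ, 0 ≤ t → J K (t • u) ≤ ENNReal.ofReal (t * (u ⬝ᵥ b)) := by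
    intro t ht
    have := (hu t ht).2.2
    rwa [hq, hcu, mul_zero, sub_zero] at this
  have hpos : ∀ᵐ x ∂K, 0 ≤ u ⬝ᵥ x := by
    have : ∀ n : ℕ, ∀ᵐ x ∂K, -1 < ((n:ℝ) • u) ⬝ᵥ x := fun n =>
      D_of_J (ne_top_of_le_ne_top ENNReal.ofReal_ne_top (hJ n n.cast_nonneg))
    filter_upwards [ae_all_iff.2 this] with x hx
    by_contra hneg
    push Not at hneg
    obtain ⟨n, hn⟩ := exists_nat_gt (1 / -(u ⬝ᵥ x))
    have := hx n
    rw [smul_dotProduct, smul_eq_mul] at this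
    rw [div_lt_iff₀ (by linarith)] at hn
    linarith
  have hint : (∫⁻ x, ENNReal.ofReal (u ⬝ᵥ x) ∂K) ≤ ENNReal.ofReal (u ⬝ᵥ b) := by
    have hm : ∀ n : ℕ, Measurable fun x =>
        ENNReal.ofReal ((((n + 1 : ℝ) * (u ⬝ᵥ x) - Real.log (1 + (n + 1 : ℝ) * (u ⬝ᵥ x))) / (n + 1))) := by
      intro n; fun_prop
    calc (∫⁻ x, ENNReal.ofReal (u ⬝ᵥ x) ∂K)
        = ∫⁻ x, liminf (fun n : ℕ => ENNReal.ofReal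
          ((((n + 1 : ℝ) * (u ⬝ᵥ x) - Real.log (1 + (n + 1 : ℝ) * (u ⬝ᵥ x))) / (n + 1)))) atTop ∂K := by
          apply lintegral_congr_ae
          filter_upwards [hpos] with x hx
          exact ((ENNReal.tendsto_ofReal (log_lim hx)).liminf_eq).symm
      _ ≤ _ := lintegral_liminf_le hm
      _ ≤ ENNReal.ofReal (u ⬝ᵥ b) := by
          refine liminf_le_of_le (by isBoundedDefault) ?_
          intro r hr
          obtain ⟨n, hn⟩ := hr.exists
          refine hn.trans ?_
          have hn0 : (0:ℝ) < n + 1 := by positivity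
          have e : ∀ᵐ x ∂K, ENNReal.ofReal
            ((((n + 1 : ℝ) * (u ⬝ᵥ x) - Real.log (1 + (n + 1 : ℝ) * (u ⬝ᵥ x))) / (n + 1)))
              = ENNReal.ofReal (1 / (n + 1)) * hE (((n + 1 : ℝ) • u) ⬝ᵥ x) := by
            filter_upwards [hpos] with x hx
            rw [smul_dotProduct, smul_eq_mul, hE_of_gt (by nlinarith), ← ENNReal.ofReal_mul (by positivity)]
            congr 1; ring
          rw [lintegral_congr_ae e, lintegral_const_mul _ (hE_dot_meas _)]
          calc _ ≤ ENNReal.ofReal (1 / (n + 1)) * ENNReal.ofReal ((n + 1) * (u ⬝ᵥ b)) := by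
                gcongr; exact hJ _ hn0.le
            _ = _ := by
                rw [← ENNReal.ofReal_mul (by positivity)]
                congr 1; field_simp
  have hN : u ∈ Nset K b c := by
    by_contra hN
    have : u ∈ Iset K b c := by
      refine ⟨⟨?_, hcu', hint⟩, hN⟩
      have := ae_iff.1 hpos
      simpa using this
    rw [hI] at this
    exact this
  have := hperp u hN
  exact dotProduct_self_eq_zero.1 this

lemma S_bdd {K : Measure (Fin d → ℝ)} {b : Fin d → ℝ} {c : Matrix (Fin d) (Fin d) ℝ}
    (hc : c.PosSemidef) (hI : Iset K b c = ∅) : ∃ R : ℝ, ∀ v ∈ S K b c, ‖v‖ ≤ R := by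
  by_contra! h
  choose v hvS hvn using fun n : ℕ => h (n + 1)
  have hpos : ∀ n, 0 < ‖v n‖ := fun n => lt_trans (by positivity) (hvn n)
  obtain ⟨u, hu, φ, hφ, hlim⟩ := (isCompact_sphere (0 : Fin d → ℝ) 1).tendsto_subseq
    (x := fun n => (‖v n‖)⁻¹ • v n) (by
      intro n
      simp [norm_smul, (hpos n).ne'])
  have : u = 0 := by
    apply ray hc hI
    intro t ht
    refine (S_closed K b c).mem_of_tendsto (hlim.const_smul t) ?_
    obtain ⟨m, hm⟩ := exists_nat_gt t
    filter_upwards [eventually_ge_atTop m] with n hn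
    simp only [Function.comp]
    rw [smul_smul]
    apply S_star hc (hvS _)
    · have := hpos (φ n); positivity
    · rw [← div_eq_mul_inv, div_le_one (hpos _)]
      have h1 : (m : ℝ) ≤ φ n := by exact_mod_cast hn.trans (hφ.id_le n)
      linarith [hvn (φ n)]
  rw [this] at hu
  simp at hu

lemma exists_max_S {K : Measure (Fin d → ℝ)} {b : Fin d → ℝ} {c : Matrix (Fin d) (Fin d) ℝ}
    (hc : c.PosSemidef) (hI : Iset K b c = ∅) : ∃ v0 ∈ S K b c, ∀ v ∈ S K b c,
      q b c v - (J K v).toReal ≤ q b c v0 - (J K v0).toReal := by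
  obtain ⟨R, hR⟩ := S_bdd hc hI
  have hcomp : IsCompact (S K b c) := by
    refine Metric.isCompact_of_isClosed_isBounded (S_closed K b c) ?_
    exact isBounded_iff_forall_norm_le.2 ⟨R, hR⟩
  obtain ⟨C, hC⟩ := (hcomp.bddAbove_image (q_cont b c).continuousOn)
  have hC' : ∀ v ∈ S K b c, q b c v ≤ C := fun v hv => hC ⟨v, hv, rfl⟩
  have hl : LowerSemicontinuous fun v => J K v + ENNReal.ofReal (C - q b c v) :=
    (J_lsc K).add (Continuous.lowerSemicontinuous
      (ENNReal.continuous_ofReal.comp (continuous_const.sub (q_cont b c))))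
  obtain ⟨v0, h0, hmin⟩ := LowerSemicontinuousOn.exists_isMinOn ⟨0, S_zero K b c⟩ hcomp
    (hl.lowerSemicontinuousOn _)
  refine ⟨v0, h0, fun v hv => ?_⟩
  have ht : ∀ w ∈ S K b c, J K w ≠ ⊤ := fun w hw =>
    ne_top_of_le_ne_top ENNReal.ofReal_ne_top hw.2.2
  have := hmin hv
  simp only [mem_ofPred_eq] at this
  have := ENNReal.toReal_mono (by simp [ht v hv]) this
  rw [ENNReal.toReal_add (ht v hv) (by simp), ENNReal.toReal_add (ht v0 h0) (by simp),
    ENNReal.toReal_ofReal (by linarith [hC' v hv, hC' v0 h0]), ENNReal.toReal_ofReal (by linarith [hC' v hv, hC' v0 h0])] at this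
  linarith

lemma N_add {K : Measure (Fin d → ℝ)} {b : Fin d → ℝ} {c : Matrix (Fin d) (Fin d) ℝ} 
    {u v : Fin d → ℝ} (hu : u ∈ Nset K b c) (hv : v ∈ Nset K b c) : u + v ∈ Nset K b c := by
  obtain ⟨h1, h2, h3⟩ := hu
  obtain ⟨k1, k2, k3⟩ := hv
  refine ⟨?_, by rw [mulVec_add, h2, k2, add_zero], by rw [add_dotProduct, h3, k3, add_zero]⟩
  refine measure_mono_null ?_ (measure_union_null h1 k1)
  intro x hx
  by_contra h
  simp only [mem_union, mem_ofPred_eq, not_or, not_not] at h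
  apply hx
  rw [add_dotProduct, h.1, h.2, add_zero]

lemma N_smul {K : Measure (Fin d → ℝ)} {b : Fin d → ℝ} {c : Matrix (Fin d) (Fin d) ℝ} 
    {u : Fin d → ℝ} (s : ℝ) (hu : u ∈ Nset K b c) : s • u ∈ Nset K b c := by
  obtain ⟨h1, h2, h3⟩ := hu
  refine ⟨?_, by rw [mulVec_smul, h2, smul_zero], by rw [smul_dotProduct, h3, smul_zero]⟩
  refine measure_mono_null ?_ h1
  intro x hx h
  apply hx
  rw [smul_dotProduct, h, smul_zero]

lemma decomp (K : Measure (Fin d → ℝ)) (b : Fin d → ℝ) (c : Matrix (Fin d) (Fin d) ℝ)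
    (v : Fin d → ℝ) : ∃ n ∈ Nset K b c, ∃ w ∈ Nperp K b c, v = n + w := by
  let N : Submodule ℝ (EuclideanSpace ℝ (Fin d)) :=
    { carrier := {v | v.ofLp ∈ Nset K b c}
      add_mem' := fun h1 h2 => N_add h1 h2
      zero_mem' := by simp [Nset]
      smul_mem' := fun s _ h => N_smul s h }
  obtain ⟨y, hy, z, hz, h⟩ := N.exists_add_mem_mem_orthogonal (WithLp.toLp 2 v)
  refine ⟨y.ofLp, hy, z.ofLp, ?_, ?_⟩
  · intro u hu
    have := (N.mem_orthogonal z).1 hz (WithLp.toLp 2 u) hu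
    rw [EuclideanSpace.inner_eq_star_dotProduct] at this
    simpa using this
  · have := congrArg WithLp.ofLp h
    simpa using this

lemma J_shift {K : Measure (Fin d → ℝ)} {b : Fin d → ℝ} {c : Matrix (Fin d) (Fin d) ℝ}
    {n w : Fin d → ℝ} (hn : n ∈ Nset K b c) : J K (n + w) = J K w := by
  apply lintegral_congr_ae
  have : ∀ᵐ x ∂K, n ⬝ᵥ x = 0 := ae_iff.2 hn.1
  filter_upwards [this] with x hx
  rw [add_dotProduct, hx, zero_add]

lemma q_shift {K : Measure (Fin d → ℝ)} {b : Fin d → ℝ} {c : Matrix (Fin d) (Fin d) ℝ}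
    (hc : c.PosSemidef) {n w : Fin d → ℝ} (hn : n ∈ Nset K b c) : q b c (n + w) = q b c w := by
  simp only [q, mulVec_add, add_dotProduct, dotProduct_add, hn.2.1, hn.2.2]
  rw [c_symm hc n w, hn.2.1]
  simp

lemma exists_max {K : Measure (Fin d → ℝ)} {b : Fin d → ℝ} {c : Matrix (Fin d) (Fin d) ℝ}
    (hc : c.PosSemidef) (hI : Iset K b c = ∅) : ∃ v0, v0 ∈ Nperp K b c ∧ J K v0 ≠ ⊤ ∧
      ∀ v ∈ Dset K, Psi K b c v ≤ Psi K b c v0 := by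
  obtain ⟨v0, h0, hmax⟩ := exists_max_S hc hI
  have ht := ne_top_of_le_ne_top ENNReal.ofReal_ne_top h0.2.2
  refine ⟨v0, h0.1, ht, fun v hv => ?_⟩
  obtain ⟨n, hn, w, hw, rfl⟩ := decomp K b c v
  by_cases hJ : J K w = ⊤
  · rw [Psi_bot hv (by rw [J_shift hn, hJ])]; exact bot_le
  rw [Psi_eq_real (by rwa [J_shift hn]), Psi_eq_real ht, J_shift hn, q_shift hc hn]
  rw [EReal.coe_le_coe_iff]
  by_cases hS : w ∈ S K b c
  · exact hmax w hS
  have hz := hmax 0 (S_zero K b c)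
  simp only [J_zero, q, zero_dotProduct] at hz
  have : q b c w - (J K w).toReal < 0 := by
    by_contra! hh
    apply hS
    have h2 : (0:ℝ) ≤ (J K w).toReal := ENNReal.toReal_nonneg
    refine ⟨hw, by linarith, ?_⟩
    rw [← ENNReal.ofReal_toReal hJ]
    exact ENNReal.ofReal_le_ofReal (by linarith)
  simp at hz
  refine this.le.trans ?_
  simpa [q] using hz

def hr (y : ℝ) : ℝ := y - Real.log (1 + y)

lemma hr_nonneg {y : ℝ} (hy : -1 < y) : 0 ≤ hr y := by
  have := Real.log_le_sub_one_of_pos (show 0 < 1 + y by linarith)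
  unfold hr; linarith

lemma hr_mid {y z : ℝ} (hy : -1 < y) (hz : -1 < z) : hr ((y + z) / 2) ≤ (hr y + hr z) / 2 ∧
    ((hr y + hr z) / 2 ≤ hr ((y + z) / 2) → y = z) := by
  by_cases h : y = z
  · subst h; refine ⟨le_of_eq ?_, fun _ => rfl⟩; rw [show (y + y) / 2 = y by ring]; ring
  have h4 := strictConcaveOn_log_Ioi.2 (show (1 + y) ∈ Ioi (0:ℝ) by simp; linarith)
    (show (1 + z) ∈ Ioi (0:ℝ) by simp; linarith) (by simpa using h)
    (by norm_num : (0:ℝ) < 1 / 2) (by norm_num : (0:ℝ) < 1 / 2) (by norm_num)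
  simp only [smul_eq_mul] at h4
  rw [show 1 / 2 * (1 + y) + 1 / 2 * (1 + z) = 1 + (y + z) / 2 by ring] at h4
  unfold hr
  refine ⟨by linarith, fun h => by exfalso; linarith⟩

lemma D_mid {K : Measure (Fin d → ℝ)} {v w : Fin d → ℝ} {s t : ℝ} (hs : 0 ≤ s) (ht : 0 ≤ t)
    (hst : s + t = 1) (hv : v ∈ Dset K) (hw : w ∈ Dset K) : s • v + t • w ∈ Dset K := by
  show ∀ᵐ x ∂K, _
  filter_upwards [hv, hw] with x h1 h2
  rw [add_dotProduct, smul_dotProduct, smul_dotProduct, smul_eq_mul, smul_eq_mul]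
  have : s = 1 - t := by linarith
  subst this
  rcases ht.eq_or_lt with rfl | ht
  · linarith
  · nlinarith

lemma uniq {K : Measure (Fin d → ℝ)} {b : Fin d → ℝ} {c : Matrix (Fin d) (Fin d) ℝ}
    (hc : c.PosSemidef) {v w : Fin d → ℝ} (hv : v ∈ Dset K) (hw : w ∈ Dset K)
    (hvp : v ∈ Nperp K b c) (hwp : w ∈ Nperp K b c)
    (hvm : ∀ u ∈ Dset K, Psi K b c u ≤ Psi K b c v)
    (hwm : ∀ u ∈ Dset K, Psi K b c u ≤ Psi K b c w) : v = w := by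
  have hvJ := J_ne_top_of_max hv hvm
  have hwJ := J_ne_top_of_max hw hwm
  have e1 := le_of_Psi hvJ hwJ (hvm w hw)
  have e2 := le_of_Psi hwJ hvJ (hwm v hv)
  set m : Fin d → ℝ := (1 / 2 : ℝ) • v + (1 / 2 : ℝ) • w with hm
  have hmD : m ∈ Dset K := D_mid (by norm_num) (by norm_num) (by norm_num) hv hw
  have hmx : ∀ x, m ⬝ᵥ x = (v ⬝ᵥ x + w ⬝ᵥ x) / 2 := by
    intro x
    rw [hm, add_dotProduct, smul_dotProduct, smul_dotProduct, smul_eq_mul, smul_eq_mul]; ring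
  have hqm : q b c m = (q b c v + q b c w) / 2 + 1 / 8 * ((v - w) ⬝ᵥ (c *ᵥ (v - w))) := by
    have := c_symm hc v w
    simp only [hm, q, mulVec_add, mulVec_smul, mulVec_sub, add_dotProduct, dotProduct_add,
      smul_dotProduct, dotProduct_smul, sub_dotProduct, dotProduct_sub, smul_eq_mul]
    rw [this]; ring
  set gap : (Fin d → ℝ) → ℝ≥0∞ := fun x =>
    ENNReal.ofReal ((hr (v ⬝ᵥ x) + hr (w ⬝ᵥ x)) / 2 - hr (m ⬝ᵥ x)) with hgap
  have hgm : Measurable gap := by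
    simp only [hgap, hr]; fun_prop
  have hsum : J K m + ∫⁻ x, gap x ∂K = ENNReal.ofReal (1 / 2) * (J K v + J K w) := by
    unfold J
    rw [← lintegral_add_left (hE_dot_meas m), ← lintegral_add_left (hE_dot_meas v),
      ← lintegral_const_mul _ (show Measurable fun x => hE (v ⬝ᵥ x) + hE (w ⬝ᵥ x) from
        (hE_dot_meas v).add (hE_dot_meas w))]
    apply lintegral_congr_ae
    filter_upwards [hv, hw, hmD] with x h1 h2 h3
    have h := (hr_mid h1 h2).1
    have k1 := hr_nonneg h1
    have k2 := hr_nonneg h2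
    have k3 := hr_nonneg h3
    rw [hE_of_gt h1, hE_of_gt h2, hE_of_gt h3]
    change ENNReal.ofReal (hr (m ⬝ᵥ x)) + ENNReal.ofReal _ = 
      ENNReal.ofReal (1 / 2) * (ENNReal.ofReal (hr (v ⬝ᵥ x)) + ENNReal.ofReal (hr (w ⬝ᵥ x)))
    rw [← hmx] at h
    rw [← ENNReal.ofReal_add k3 (by linarith), ← ENNReal.ofReal_add k1 k2,
      ← ENNReal.ofReal_mul (by norm_num)]
    congr 1; ring
  have hfin : J K m + ∫⁻ x, gap x ∂K ≠ ⊤ := by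
    rw [hsum]; exact ENNReal.mul_ne_top (by simp) (by simp [hvJ, hwJ])
  obtain ⟨hmJ, hgJ⟩ := ENNReal.add_ne_top.1 hfin
  have hsr := congrArg ENNReal.toReal hsum
  rw [ENNReal.toReal_add hmJ hgJ, ENNReal.toReal_mul, ENNReal.toReal_add hvJ hwJ,
    ENNReal.toReal_ofReal (by norm_num)] at hsr
  have e3 := le_of_Psi hvJ hmJ (hvm m hmD)
  have hcn := c_nonneg hc (v - w)
  have hgn : 0 ≤ (∫⁻ x, gap x ∂K).toReal := ENNReal.toReal_nonneg
  have hg0 : (∫⁻ x, gap x ∂K).toReal = 0 := by linarith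
  have hc0 : (v - w) ⬝ᵥ (c *ᵥ (v - w)) = 0 := by linarith
  have hg1 : ∫⁻ x, gap x ∂K = 0 := by
    rcases (ENNReal.toReal_eq_zero_iff _).1 hg0 with h | h
    · exact h
    · exact absurd h hgJ
  rw [lintegral_eq_zero_iff hgm] at hg1
  have hxeq : ∀ᵐ x ∂K, v ⬝ᵥ x = w ⬝ᵥ x := by
    filter_upwards [hv, hw, hg1] with x h1 h2 h3
    apply (hr_mid h1 h2).2
    have : gap x = 0 := h3
    simp only [hgap, ENNReal.ofReal_eq_zero] at this
    rw [← hmx]; linarith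
  have hJeq : J K v = J K w := by
    apply lintegral_congr_ae
    filter_upwards [hxeq] with x hx
    rw [hx]
  have hcz := c_zero hc hc0
  have hcz' : c *ᵥ v = c *ᵥ w := by rw [mulVec_sub] at hcz; exact sub_eq_zero.1 hcz
  have hqq : v ⬝ᵥ (c *ᵥ v) = w ⬝ᵥ (c *ᵥ w) := by
    rw [hcz', c_symm hc v w, hcz']
  have hN : v - w ∈ Nset K b c := by
    refine ⟨?_, hcz, ?_⟩
    · rw [← ae_iff (p := fun x => (v - w) ⬝ᵥ x = 0)]
      filter_upwards [hxeq] with x hx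
      rw [sub_dotProduct, hx, sub_self]
    · rw [hJeq] at e1 e2
      simp only [q, hqq] at e1 e2
      rw [sub_dotProduct]; linarith
  have : (v - w) ⬝ᵥ (v - w) = 0 := by
    rw [sub_dotProduct, hvp _ hN, hwp _ hN, sub_self]
  exact sub_eq_zero.1 (dotProduct_self_eq_zero.1 this)

lemma abs_dot_le (v x : Fin d → ℝ) : |v ⬝ᵥ x| ≤ eucNorm v * eucNorm x := by
  unfold eucNorm
  rw [← Real.sqrt_mul (by simpa using dotProduct_star_self_nonneg v)]
  apply Real.abs_le_sqrt
  simp only [dotProduct]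
  have := Finset.sum_mul_sq_le_sq_mul_sq Finset.univ v x
  simpa [pow_two] using this

lemma G_bound {y y0 ε R : ℝ} (hy : -1 < y) (hy0 : -1 < y0) (he : 0 ≤ ε) (he1 : ε ≤ 1 / 2)
    (hR : |y| + |y0| ≤ R) :
    (y - y0) * ((y0 + ε * (y - y0)) / (1 + (y0 + ε * (y - y0)))) ≤ 8 * min R (R ^ 2) := by
  set z := y0 + ε * (y - y0) with hz
  have a1 := le_abs_self y
  have a2 := neg_abs_le y
  have a3 := le_abs_self y0
  have a4 := neg_abs_le y0
  have hR0 : 0 ≤ R := (by positivity : 0 ≤ |y| + |y0|).trans hR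
  have hd : |y - y0| ≤ R := (abs_sub y y0).trans hR
  have hzz : z = (1 - ε) * y0 + ε * y := by rw [hz]; ring
  have hzR : |z| ≤ R := by
    rw [hzz]
    refine (abs_add_le _ _).trans ?_
    rw [abs_mul, abs_mul, abs_of_nonneg he, abs_of_nonneg (by linarith : 0 ≤ 1 - ε)]
    nlinarith [abs_nonneg y, abs_nonneg y0]
  have hz1 : (1 + y0) / 2 ≤ 1 + z := by rw [hzz]; nlinarith
  have hzp : 0 < 1 + z := by linarith
  rcases le_or_gt R (1 / 2) with h | h
  · have b : (y - y0) * (z / (1 + z)) ≤ 2 * R ^ 2 := by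
      rw [← mul_div_assoc, div_le_iff₀ hzp]
      have : (y - y0) * z ≤ R * R := by
        refine (le_abs_self _).trans ?_
        rw [abs_mul]
        exact mul_le_mul hd hzR (abs_nonneg _) hR0
      nlinarith [neg_abs_le z, sq_nonneg R]
    rw [min_eq_right (by nlinarith)]
    nlinarith
  · have b : (y - y0) * (z / (1 + z)) ≤ 4 * R := by
      rw [← mul_div_assoc, div_le_iff₀ hzp]
      rcases le_or_gt 0 z with hz0 | hz0
      · nlinarith [le_abs_self (y - y0), mul_nonneg hR0 hz0]
      · rcases le_or_gt y0 y with hyy | hyy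
        · nlinarith [mul_nonneg hR0 hzp.le]
        · nlinarith [mul_nonneg hR0 hzp.le]
    have : R ≤ 2 * min R (R ^ 2) := by
      rcases min_choice R (R ^ 2) with h' | h' <;> rw [h'] <;> nlinarith
    linarith

lemma min_scale {r M : ℝ} (hr : 0 ≤ r) (hM : 1 ≤ M) :
    min (M * r) ((M * r) ^ 2) ≤ M ^ 2 * min r (r ^ 2) := by
  rcases min_choice r (r ^ 2) with h' | h' <;> rw [h']
  · exact (min_le_left _ _).trans (by nlinarith [mul_nonneg (sub_nonneg.2 hM) hr])
  · exact (min_le_right _ _).trans (by nlinarith)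

lemma hr_tangent {y0 z : ℝ} (hy0 : -1 < y0) (hz : -1 < z) :
    hr z - (z - y0) * (z / (1 + z)) ≤ hr y0 := by
  have h1 : 0 < 1 + y0 := by linarith
  have h2 : 0 < 1 + z := by linarith
  have := Real.log_le_sub_one_of_pos (div_pos h1 h2)
  rw [Real.log_div h1.ne' h2.ne'] at this
  unfold hr
  have e : (z - y0) * (z / (1 + z)) = (z - y0) + ((1 + y0) / (1 + z) - 1) := by
    field_simp; ring
  rw [e]; linarith

lemma third {K : Measure (Fin d → ℝ)} {b : Fin d → ℝ} {c : Matrix (Fin d) (Fin d) ℝ}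
    (hc : c.PosSemidef) (hK : LevyIntegrable K) {v v0 : Fin d → ℝ} (hv : v ∈ Dset K)
    (hv0 : v0 ∈ Dset K) (hm : ∀ u ∈ Dset K, Psi K b c u ≤ Psi K b c v0) :
    Fval K b c v v0 ≤ 0 := by
  have hJ0 := J_ne_top_of_max hv0 hm
  set M : ℝ := 1 + eucNorm v + eucNorm v0 with hM
  have hev : 0 ≤ eucNorm v := Real.sqrt_nonneg _
  have hev0 : 0 ≤ eucNorm v0 := Real.sqrt_nonneg _
  have hM1 : 1 ≤ M := by linarith
  set g : (Fin d → ℝ) → ℝ := fun x => 8 * M ^ 2 * min (eucNorm x) (eucNorm x ^ 2) with hg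
  set G : ℝ → (Fin d → ℝ) → ℝ := fun ε x =>
    ((v - v0) ⬝ᵥ x) * ((v0 ⬝ᵥ x + ε * ((v - v0) ⬝ᵥ x)) / (1 + (v0 ⬝ᵥ x + ε * ((v - v0) ⬝ᵥ x)))) with hG
  have hgm : Measurable g := by simp only [hg, eucNorm]; fun_prop
  have hGm : ∀ ε, Measurable (G ε) := by intro ε; simp only [hG]; fun_prop
  have hg0 : ∀ x, 0 ≤ g x := by
    intro x
    have : 0 ≤ eucNorm x := Real.sqrt_nonneg _
    simp only [hg]; positivity
  have hgfin : ∫⁻ x, ENNReal.ofReal (g x) ∂K ≠ ⊤ := by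
    simp only [hg]
    have : ∀ x : Fin d → ℝ, ENNReal.ofReal (8 * M ^ 2 * min (eucNorm x) (eucNorm x ^ 2))
      = ENNReal.ofReal (8 * M ^ 2) * ENNReal.ofReal (min (eucNorm x) (eucNorm x ^ 2)) :=
      fun x => ENNReal.ofReal_mul (by positivity)
    simp_rw [this]
    rw [lintegral_const_mul _ (by unfold eucNorm; fun_prop)]
    exact ENNReal.mul_ne_top ENNReal.ofReal_ne_top hK
  have hGg : ∀ ε, 0 ≤ ε → ε ≤ 1 / 2 → ∀ᵐ x ∂K, G ε x ≤ g x := by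
    intro ε h0 h1
    filter_upwards [hv, hv0] with x hx hx0
    have hex : 0 ≤ eucNorm x := Real.sqrt_nonneg _
    have h := G_bound hx hx0 h0 h1 (R := M * eucNorm x) (by
      have := abs_dot_le v x
      have := abs_dot_le v0 x
      rw [hM]; nlinarith)
    simp only [hG, hg, sub_dotProduct]
    have := min_scale hex hM1
    linarith
  set L : ℝ := (v - v0) ⬝ᵥ (b - c *ᵥ v0) with hL
  set A : ℝ := (v - v0) ⬝ᵥ (c *ᵥ (v - v0)) with hA
  set Ig : ℝ := (∫⁻ x, ENNReal.ofReal (g x) ∂K).toReal with hIg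
  have hqe : ∀ ε : ℝ, q b c (v0 + ε • (v - v0)) - q b c v0 = ε * (L - ε / 2 * A) := by
    intro ε
    have h := c_symm hc v0 (v - v0)
    simp only [hL, hA, q]
    generalize v - v0 = w at *
    simp only [mulVec_add, mulVec_smul, add_dotProduct, dotProduct_add,
      smul_dotProduct, dotProduct_smul, dotProduct_sub, smul_eq_mul]
    rw [h]; ring
  have key : ∀ ε, 0 < ε → ε ≤ 1 / 2 →
      ∫⁻ x, ENNReal.ofReal (g x - G ε x) ∂K ≤ ENNReal.ofReal (Ig - (L - ε / 2 * A)) ∧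
      0 ≤ Ig - (L - ε / 2 * A) := by
    intro ε h0 h1
    set w := v0 + ε • (v - v0) with hw
    have hwD : w ∈ Dset K := by
      have : w = (1 - ε) • v0 + ε • v := by rw [hw, smul_sub, sub_smul, one_smul]; abel
      rw [this]
      exact D_mid (by linarith) h0.le (by ring) hv0 hv
    have hwx : ∀ x, w ⬝ᵥ x = v0 ⬝ᵥ x + ε * ((v - v0) ⬝ᵥ x) := by
      intro x; rw [hw, add_dotProduct, smul_dotProduct, smul_eq_mul]
    have hineq : J K w + ENNReal.ofReal ε * ∫⁻ x, ENNReal.ofReal (g x - G ε x) ∂K ≤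
        J K v0 + ENNReal.ofReal ε * ∫⁻ x, ENNReal.ofReal (g x) ∂K := by
      unfold J
      have m1 := (hgm.sub (hGm ε)).ennreal_ofReal
      simp only [Pi.sub_apply] at m1
      rw [← lintegral_const_mul _ m1, ← lintegral_const_mul _ hgm.ennreal_ofReal,
        ← lintegral_add_left (hE_dot_meas w), ← lintegral_add_left (hE_dot_meas v0)]
      apply lintegral_mono_ae
      filter_upwards [hv0, hwD, hGg ε h0.le h1] with x k1 k2 k3
      rw [hE_of_gt k1, hE_of_gt k2]
      change ENNReal.ofReal (hr (w ⬝ᵥ x)) + _ ≤ ENNReal.ofReal (hr (v0 ⬝ᵥ x)) + _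
      have n1 := hr_nonneg k1
      have n2 := hr_nonneg k2
      have n3 : 0 ≤ ε * (g x - G ε x) := mul_nonneg h0.le (by linarith)
      have n4 : 0 ≤ ε * g x := mul_nonneg h0.le (hg0 x)
      rw [← ENNReal.ofReal_mul h0.le, ← ENNReal.ofReal_mul h0.le, ← ENNReal.ofReal_add n2 n3,
        ← ENNReal.ofReal_add n1 n4]
      apply ENNReal.ofReal_le_ofReal
      have t := hr_tangent k1 k2
      have : ε * G ε x = (w ⬝ᵥ x - v0 ⬝ᵥ x) * (w ⬝ᵥ x / (1 + w ⬝ᵥ x)) := by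
        simp only [hG]; rw [hwx]; ring
      rw [← this] at t
      linarith
    have hfin : J K v0 + ENNReal.ofReal ε * ∫⁻ x, ENNReal.ofReal (g x) ∂K ≠ ⊤ :=
      ENNReal.add_ne_top.2 ⟨hJ0, ENNReal.mul_ne_top (by simp) hgfin⟩
    obtain ⟨f1, f2⟩ := ENNReal.add_ne_top.1 (ne_top_of_le_ne_top hfin hineq)
    have f3 : ∫⁻ x, ENNReal.ofReal (g x - G ε x) ∂K ≠ ⊤ := by
      intro h
      rw [h, ENNReal.mul_top (by simpa using h0)] at f2
      exact f2 rfl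
    have hreal := ENNReal.toReal_mono hfin hineq
    rw [ENNReal.toReal_add f1 f2, ENNReal.toReal_add hJ0 (ENNReal.mul_ne_top (by simp) hgfin),
      ENNReal.toReal_mul, ENNReal.toReal_mul, ENNReal.toReal_ofReal h0.le] at hreal
    have hopt := le_of_Psi hJ0 f1 (hm w hwD)
    have hq' := hqe ε
    rw [← hw] at hq'
    have : ε * (∫⁻ x, ENNReal.ofReal (g x - G ε x) ∂K).toReal ≤ ε * (Ig - (L - ε / 2 * A)) := by
      rw [hIg]; linarith
    have h5 := le_of_mul_le_mul_left this h0
    refine ⟨?_, ENNReal.toReal_nonneg.trans h5⟩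
    rw [← ENNReal.ofReal_toReal f3]
    exact ENNReal.ofReal_le_ofReal h5
  -- pass to the limit
  set e : ℕ → ℝ := fun n => 1 / ((n : ℝ) + 1 + 1) with he
  have hepos : ∀ n, 0 < e n := fun n => by simp only [he]; positivity
  have hele : ∀ n, e n ≤ 1 / 2 := fun n => by
    simp only [he]
    apply one_div_le_one_div_of_le (by norm_num)
    have : (0:ℝ) ≤ n := n.cast_nonneg
    linarith
  have hetend : Tendsto e atTop (𝓝 0) := by
    have := (tendsto_one_div_add_atTop_nhds_zero_nat (𝕜 := ℝ)).comp (tendsto_add_atTop_nat 1)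
    refine this.congr fun n => ?_
    simp [he]
  have htl : Tendsto (fun n => Ig - (L - e n / 2 * A)) atTop (𝓝 (Ig - L)) := by
    have := ((((hetend.div_const 2).mul_const A).const_sub L)).const_sub Ig
    simpa using this
  have hIgL : 0 ≤ Ig - L :=
    ge_of_tendsto htl (Eventually.of_forall fun n => (key _ (hepos n) (hele n)).2)
  have hlim0 : ∫⁻ x, ENNReal.ofReal (g x - G 0 x) ∂K ≤ ENNReal.ofReal (Ig - L) := by
    calc ∫⁻ x, ENNReal.ofReal (g x - G 0 x) ∂K
        = ∫⁻ x, liminf (fun n => ENNReal.ofReal (g x - G (e n) x)) atTop ∂K := by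
          apply lintegral_congr_ae
          filter_upwards [hv0] with x hx
          symm
          apply Tendsto.liminf_eq
          apply ENNReal.tendsto_ofReal
          apply Tendsto.const_sub
          have hcont : ContinuousAt (fun ε => G ε x) 0 := by
            simp only [hG]
            refine ContinuousAt.mul continuousAt_const (ContinuousAt.div (by fun_prop) (by fun_prop) ?_)
            simp only [zero_mul, add_zero]
            linarith
          exact hcont.tendsto.comp hetend
      _ ≤ liminf (fun n => ∫⁻ x, ENNReal.ofReal (g x - G (e n) x) ∂K) atTop :=
          lintegral_liminf_le fun n => (hgm.sub (hGm _)).ennreal_ofReal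
      _ ≤ liminf (fun n => ENNReal.ofReal (Ig - (L - e n / 2 * A))) atTop := by
          refine liminf_le_liminf ?_
          exact Eventually.of_forall fun n => (key _ (hepos n) (hele n)).1
      _ = ENNReal.ofReal (Ig - L) := by
          apply Tendsto.liminf_eq
          exact ENNReal.tendsto_ofReal htl
  -- conclude
  have hGae := hGg 0 le_rfl (by norm_num)
  set P := ∫⁻ x, ENNReal.ofReal (max (G 0 x) 0) ∂K with hP
  set Q := ∫⁻ x, ENNReal.ofReal (max (-(G 0 x)) 0) ∂K with hQ
  have hPfin : P ≠ ⊤ := by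
    refine ne_top_of_le_ne_top hgfin (lintegral_mono_ae ?_)
    filter_upwards [hGae] with x hx
    exact ENNReal.ofReal_le_ofReal (max_le hx (hg0 x))
  have hsum : (∫⁻ x, ENNReal.ofReal (g x - G 0 x) ∂K) + P = (∫⁻ x, ENNReal.ofReal (g x) ∂K) + Q := by
    rw [hP, hQ, ← lintegral_add_right _ ((hGm 0).max measurable_const).ennreal_ofReal,
      ← lintegral_add_left hgm.ennreal_ofReal]
    apply lintegral_congr_ae
    filter_upwards [hGae] with x hx
    rw [← ENNReal.ofReal_add (by linarith) (le_max_right _ _),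
      ← ENNReal.ofReal_add (hg0 x) (le_max_right _ _)]
    congr 1
    rcases le_total 0 (G 0 x) with h | h
    · rw [max_eq_left h, max_eq_right (by linarith)]; ring
    · rw [max_eq_right h, max_eq_left (by linarith)]; ring
  have hDfin := ne_top_of_le_ne_top ENNReal.ofReal_ne_top hlim0
  have hQfin : Q ≠ ⊤ := by
    have : (∫⁻ x, ENNReal.ofReal (g x - G 0 x) ∂K) + P ≠ ⊤ := ENNReal.add_ne_top.2 ⟨hDfin, hPfin⟩
    rw [hsum] at this
    exact (ENNReal.add_ne_top.1 this).2
  have hr1 := congrArg ENNReal.toReal hsum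
  rw [ENNReal.toReal_add hDfin hPfin, ENNReal.toReal_add hgfin hQfin] at hr1
  have hr2 := ENNReal.toReal_mono ENNReal.ofReal_ne_top hlim0
  rw [ENNReal.toReal_ofReal hIgL] at hr2
  have hF : Fval K b c v v0 = ((L - (P.toReal - Q.toReal) : ℝ) : EReal) := by
    rw [EReal.coe_sub, EReal.coe_sub, EReal.coe_ennreal_toReal hPfin, EReal.coe_ennreal_toReal hQfin]
    simp only [Fval, hP, hQ, hG, zero_mul, add_zero, hL]
  rw [hF]
  have : L - (P.toReal - Q.toReal) ≤ 0 := by linarith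
  exact_mod_cast this

end Aux

/-- Suppose `I = ∅`.  Then `sup_{v ∈ D} Ψ(v) < ∞` and there is a unique `v⁰ ∈ D ∩ N^⊥`
with `Ψ(v⁰) = sup_{v ∈ D} Ψ(v)`.  Moreover, for any point `v⁰ ∈ D` at which the supremum
of `Ψ` over `D` is attained, one has `F(v, v⁰) ≤ 0` for every `v ∈ D`. -/
theorem stmt_10 (hd : 1 ≤ d) (K : Measure (Fin d → ℝ)) (hK0 : K {0} = 0)
    (hKint : LevyIntegrable K) (b : Fin d → ℝ) (c : Matrix (Fin d) (Fin d) ℝ)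
    (hc : c.PosSemidef) (hI : Iset K b c = ∅) :
    (∃ M : ℝ, ∀ v ∈ Dset K, Psi K b c v ≤ (M : EReal)) ∧
    (∃! v0 : Fin d → ℝ, (v0 ∈ Dset K ∧ v0 ∈ Nperp K b c) ∧
      ∀ v ∈ Dset K, Psi K b c v ≤ Psi K b c v0) ∧
    (∀ v0 ∈ Dset K, (∀ v ∈ Dset K, Psi K b c v ≤ Psi K b c v0) →
      ∀ v ∈ Dset K, Fval K b c v v0 ≤ 0) := by
  obtain ⟨v0, hp, hJ, hmax⟩ := Aux.exists_max hc hI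
  have hD := Aux.D_of_J hJ
  refine ⟨⟨Aux.q b c v0 - (Aux.J K v0).toReal, fun v hv => ?_⟩,
    ⟨v0, ⟨⟨hD, hp⟩, hmax⟩, ?_⟩, ?_⟩
  · rw [← Aux.Psi_eq_real hJ]; exact hmax v hv
  · rintro w ⟨⟨hwD, hwp⟩, hwm⟩
    exact Aux.uniq hc hwD hD hwp hp hwm hmax
  · intro w hw hwm v hv
    exact Aux.third hc hKint hv hw hwm
end
end

section
/- For every a ∈ [0, 1), the function Ψ is real-valued and continuous on the closed convex set aD̄ := {v ∈ ℝ^d : v·x ≥ −a for K-a.e. x}. -/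
open MeasureTheory Filter Set Matrix
open scoped ENNReal

noncomputable section

variable {d : ℕ}

lemma aux_dot (v x : Fin d → ℝ) : |v ⬝ᵥ x| ≤ eucNorm v * eucNorm x := by
  have h : (v ⬝ᵥ x) ^ 2 ≤ (v ⬝ᵥ v) * (x ⬝ᵥ x) := by
    have := Finset.sum_mul_sq_le_sq_mul_sq Finset.univ v x
    simpa [dotProduct, pow_two] using this
  have hv : 0 ≤ v ⬝ᵥ v := by
    simp only [dotProduct]; exact Finset.sum_nonneg fun i _ => mul_self_nonneg _
  unfold eucNorm
  rw [← Real.sqrt_mul hv]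
  exact Real.abs_le_sqrt h

lemma aux_nonneg (x : Fin d → ℝ) : 0 ≤ eucNorm x := Real.sqrt_nonneg _

lemma aux_cont_dot (x : Fin d → ℝ) : Continuous fun v : Fin d → ℝ => v ⬝ᵥ x := by
  simp only [dotProduct]; fun_prop

lemma aux_cont_dot' (v : Fin d → ℝ) : Continuous fun x : Fin d → ℝ => v ⬝ᵥ x := by
  simp only [dotProduct]; fun_prop

lemma aux_cont_norm : Continuous (eucNorm : (Fin d → ℝ) → ℝ) := by
  unfold eucNorm
  simp only [dotProduct]; fun_prop

lemma aux_log {a y : ℝ} (ha0 : 0 ≤ a) (ha1 : a < 1) (hy : -a ≤ y) :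
    y - Real.log (1 + y) ≤ (1 - a)⁻¹ * min |y| (y ^ 2) := by
  have h1 : 0 < 1 + y := by linarith
  have h0 : 0 < 1 - a := by linarith
  have hl := Real.one_sub_inv_le_log_of_pos h1
  have h2 : y - Real.log (1 + y) ≤ y ^ 2 / (1 + y) := by
    have : y ^ 2 / (1 + y) = y - (1 - (1 + y)⁻¹) := by field_simp; ring
    linarith
  refine h2.trans ?_
  rw [inv_mul_eq_div, div_le_div_iff₀ h1 h0]
  rcases le_total |y| (y ^ 2) with h | h
  · rw [min_eq_left h]
    rcases abs_cases y with ⟨e, _⟩ | ⟨e, _⟩ <;> rw [e] <;> nlinarith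
  · rw [min_eq_right h]
    nlinarith [sq_nonneg y]

lemma aux_bound {a M : ℝ} (ha0 : 0 ≤ a) (ha1 : a < 1) (hM : 1 ≤ M) {v x : Fin d → ℝ}
    (hv : eucNorm v ≤ M) (hy : -a ≤ v ⬝ᵥ x) :
    v ⬝ᵥ x - Real.log (1 + v ⬝ᵥ x) ≤
      ((1 - a)⁻¹ * M ^ 2) * min (eucNorm x) (eucNorm x ^ 2) := by
  have h0 : 0 < (1 - a)⁻¹ := by rw [inv_pos]; linarith
  refine (aux_log ha0 ha1 hy).trans ?_
  rw [mul_assoc]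
  refine mul_le_mul_of_nonneg_left ?_ h0.le
  have hx := aux_nonneg x
  have h1 : |v ⬝ᵥ x| ≤ M * eucNorm x :=
    (aux_dot v x).trans (mul_le_mul_of_nonneg_right hv hx)
  have hMM : M ≤ M ^ 2 := by nlinarith
  rw [mul_min_of_nonneg _ _ (sq_nonneg M)]
  refine min_le_min ?_ ?_
  · exact h1.trans (mul_le_mul_of_nonneg_right hMM hx)
  · rw [← sq_abs, ← mul_pow]
    exact pow_le_pow_left₀ (abs_nonneg _) h1 2

lemma aux_fin {K : Measure (Fin d → ℝ)} (hKint : LevyIntegrable K) (C : ℝ) (hC : 0 ≤ C) :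
    ∫⁻ x, ENNReal.ofReal (C * min (eucNorm x) (eucNorm x ^ 2)) ∂K ≠ ⊤ := by
  simp_rw [ENNReal.ofReal_mul hC]
  rw [lintegral_const_mul' _ _ ENNReal.ofReal_ne_top]
  exact ENNReal.mul_ne_top ENNReal.ofReal_ne_top hKint

/-- For every `a ∈ [0, 1)`, the set `aD̄ = {v ∈ ℝ^d : v·x ≥ −a for K-a.e. x}` is a closed
convex set on which the function `Ψ` is real-valued and continuous. -/
theorem stmt_11 (hd : 1 ≤ d) (K : Measure (Fin d → ℝ)) (hK0 : K {0} = 0)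
    (hKint : LevyIntegrable K) (b : Fin d → ℝ) (c : Matrix (Fin d) (Fin d) ℝ)
    (hc : c.PosSemidef) (a : ℝ) (ha0 : 0 ≤ a) (ha1 : a < 1) :
    IsClosed {v : Fin d → ℝ | ∀ᵐ x ∂K, -a ≤ v ⬝ᵥ x} ∧
    Convex ℝ {v : Fin d → ℝ | ∀ᵐ x ∂K, -a ≤ v ⬝ᵥ x} ∧
    (∀ v ∈ {v : Fin d → ℝ | ∀ᵐ x ∂K, -a ≤ v ⬝ᵥ x},
      Psi K b c v ≠ ⊥ ∧ Psi K b c v ≠ ⊤) ∧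
    ContinuousOn (Psi K b c) {v : Fin d → ℝ | ∀ᵐ x ∂K, -a ≤ v ⬝ᵥ x} := by
  have hinv : 0 < (1 - a)⁻¹ := by rw [inv_pos]; linarith
  have hfin : ∀ v ∈ {v : Fin d → ℝ | ∀ᵐ x ∂K, -a ≤ v ⬝ᵥ x},
      ∫⁻ x, ENNReal.ofReal (v ⬝ᵥ x - Real.log (1 + v ⬝ᵥ x)) ∂K ≠ ⊤ := by
    intro v hv
    have hv' : ∀ᵐ x ∂K, -a ≤ v ⬝ᵥ x := hv
    refine ne_top_of_le_ne_top
      (aux_fin hKint ((1 - a)⁻¹ * (eucNorm v + 1) ^ 2) (by positivity)) (lintegral_mono_ae ?_)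
    filter_upwards [hv'] with x hx
    exact ENNReal.ofReal_le_ofReal
      (aux_bound ha0 ha1 (by linarith [aux_nonneg v]) (by linarith) hx)
  have hreal : ∀ v ∈ {v : Fin d → ℝ | ∀ᵐ x ∂K, -a ≤ v ⬝ᵥ x},
      Psi K b c v = (((v ⬝ᵥ b - (1 / 2) * (v ⬝ᵥ (c *ᵥ v))) -
        (∫⁻ x, ENNReal.ofReal (v ⬝ᵥ x - Real.log (1 + v ⬝ᵥ x)) ∂K).toReal : ℝ) : EReal) := by
    intro v hv
    unfold Psi
    rw [EReal.coe_sub _ (ENNReal.toReal _), EReal.coe_ennreal_toReal (hfin v hv)]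
  refine ⟨?_, ?_, ?_, ?_⟩
  · refine IsSeqClosed.isClosed ?_
    intro u v hu huv
    have hu' : ∀ᵐ x ∂K, ∀ n, -a ≤ u n ⬝ᵥ x := ae_all_iff.2 hu
    show ∀ᵐ x ∂K, -a ≤ v ⬝ᵥ x
    filter_upwards [hu'] with x hx
    exact ge_of_tendsto' (((aux_cont_dot x).tendsto v).comp huv) hx
  · intro v hv w hw s t hs ht hst
    have hv' : ∀ᵐ x ∂K, -a ≤ v ⬝ᵥ x := hv
    have hw' : ∀ᵐ x ∂K, -a ≤ w ⬝ᵥ x := hw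
    show ∀ᵐ x ∂K, -a ≤ (s • v + t • w) ⬝ᵥ x
    filter_upwards [hv', hw'] with x h1 h2
    rw [add_dotProduct, smul_dotProduct, smul_dotProduct, smul_eq_mul, smul_eq_mul]
    have e : -a = s * -a + t * -a := by rw [← add_mul, hst, one_mul]
    rw [e]
    exact add_le_add (mul_le_mul_of_nonneg_left h1 hs) (mul_le_mul_of_nonneg_left h2 ht)
  · intro v hv
    rw [hreal v hv]
    exact ⟨EReal.coe_ne_bot _, EReal.coe_ne_top _⟩
  · refine ContinuousOn.congr ?_ hreal
    refine continuous_coe_real_ereal.comp_continuousOn ?_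
    refine ContinuousOn.sub ?_ ?_
    · refine Continuous.continuousOn ?_
      simp only [dotProduct, mulVec]; fun_prop
    · intro v hv
      refine (ENNReal.tendsto_toReal (hfin v hv)).comp ?_
      refine tendsto_lintegral_filter_of_dominated_convergence
        (fun x => ENNReal.ofReal (((1 - a)⁻¹ * (eucNorm v + 1) ^ 2) *
          min (eucNorm x) (eucNorm x ^ 2))) ?_ ?_
        (aux_fin hKint ((1 - a)⁻¹ * (eucNorm v + 1) ^ 2) (by positivity)) ?_
      · refine Eventually.of_forall fun w => ?_
        have := (aux_cont_dot' w).measurable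
        fun_prop
      · have hn : ∀ᶠ w in nhds v, eucNorm w < eucNorm v + 1 :=
          (aux_cont_norm.tendsto v).eventually (gt_mem_nhds (by linarith))
        filter_upwards [nhdsWithin_le_nhds hn, self_mem_nhdsWithin] with w h1 h2
        have h2' : ∀ᵐ x ∂K, -a ≤ w ⬝ᵥ x := h2
        filter_upwards [h2'] with x hx
        exact ENNReal.ofReal_le_ofReal
          (aux_bound ha0 ha1 (by linarith [aux_nonneg v]) h1.le hx)
      · have hv' : ∀ᵐ x ∂K, -a ≤ v ⬝ᵥ x := hv
        filter_upwards [hv'] with x hx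
        refine Tendsto.mono_left ?_ nhdsWithin_le_nhds
        refine ENNReal.tendsto_ofReal ?_
        have hd := (aux_cont_dot x).tendsto v
        exact hd.sub ((hd.const_add 1).log (by linarith))
end
end

section
/- Let K be a nonnegative measure on ℝ with ∫ (|x|² ∧ 1) K(dx) < ∞ and K((n, ∞)) > 0 for every n ≥ 1. Then for every ε > 0 and every N > 0 there exists a continuous function Y : ℝ → (0, ∞) such that: ∫ |Y(x) − 1| K(dx) ≤ ε; ∫ (|x| ∧ x²) Y(x) K(dx) < ∞; ∫ |x Y(x) − x 1_{{|x| ≤ 1}}| K(dx) < ∞; and ∫ (x Y(x) − x 1_{{|x| ≤ 1}}) K(dx) ≥ N. -/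
open MeasureTheory Set

lemma aux_int (K : Measure ℝ) (hmin : Integrable (fun x : ℝ => min (x ^ 2) 1) K)
    (f : ℝ → ℝ) (hf : Measurable f) (C : ℝ) (h : ∀ x, |f x| ≤ C * min (x ^ 2) 1) :
    Integrable f K :=
  (hmin.const_mul C).mono' hf.aestronglyMeasurable (Filter.Eventually.of_forall h)

lemma aux_min_cases (x : ℝ) : (|x| ≤ 1 ∧ min (x ^ 2) 1 = x ^ 2 ∧ min |x| (x ^ 2) = x ^ 2) ∨
    (1 < |x| ∧ min (x ^ 2) 1 = 1 ∧ min |x| (x ^ 2) = |x|) := by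
  rcases le_or_gt |x| 1 with h | h
  · left
    have : x ^ 2 = |x| ^ 2 := (sq_abs x).symm
    have h0 := abs_nonneg x
    exact ⟨h, min_eq_left (by nlinarith), min_eq_right (by nlinarith)⟩
  · right
    have : x ^ 2 = |x| ^ 2 := (sq_abs x).symm
    exact ⟨h, min_eq_right (by nlinarith), min_eq_left (by nlinarith)⟩

lemma aux_Y0 (a : ℝ) (ha : 1 ≤ a) (x : ℝ) : 0 < a / max a |x| ∧ a / max a |x| ≤ 1 ∧
    (|x| ≤ a → a / max a |x| = 1) ∧ |x| * (a / max a |x|) ≤ a := by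
  have hm : 0 < max a |x| := lt_of_lt_of_le (by linarith) (le_max_left _ _)
  refine ⟨by positivity, (div_le_one hm).2 (le_max_left _ _), fun h => ?_, ?_⟩
  · rw [max_eq_left h, div_self (by linarith)]
  · rw [← mul_div_assoc, div_le_iff₀ hm]
    nlinarith [le_max_right a |x|]

lemma aux_Y0_sub (a : ℝ) (ha : 1 ≤ a) (x : ℝ) : |a / max a |x| - 1| ≤ 1 * min (x ^ 2) 1 := by
  obtain ⟨h1, h2, h3, h4⟩ := aux_Y0 a ha x
  rcases aux_min_cases x with ⟨h, e, -⟩ | ⟨h, e, -⟩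
  · rw [h3 (by linarith), e]; simp; positivity
  · rw [e, abs_le]; constructor <;> linarith

noncomputable def auxPsi (b x : ℝ) : ℝ := min (max (x - b) 0) 1

lemma auxPsi_nonneg (b x : ℝ) : 0 ≤ auxPsi b x := le_min (le_max_right _ _) zero_le_one
lemma auxPsi_le (b x : ℝ) : auxPsi b x ≤ 1 := min_le_right _ _
lemma auxPsi_zero {b x : ℝ} (h : x ≤ b) : auxPsi b x = 0 := by
  unfold auxPsi; rw [max_eq_right (by linarith)]; simp
lemma auxPsi_pos {b x : ℝ} (h : b < x) : 0 < auxPsi b x :=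
  lt_min (lt_max_of_lt_left (by linarith)) one_pos
lemma auxPsi_cont (b : ℝ) : Continuous (auxPsi b) := by unfold auxPsi; fun_prop

lemma auxPsi_bd (b : ℝ) (hb : 1 ≤ b) (x : ℝ) : |auxPsi b x| ≤ 1 * min (x ^ 2) 1 := by
  rw [abs_of_nonneg (auxPsi_nonneg b x)]
  rcases aux_min_cases x with ⟨h, e, -⟩ | ⟨h, e, -⟩
  · rw [auxPsi_zero (by linarith [le_abs_self x]), e]; positivity
  · rw [e]; linarith [auxPsi_le b x]

lemma aux_g (b : ℝ) (hb : 1 ≤ b) (x : ℝ) : 0 ≤ auxPsi b x / max x 1 ∧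
    x * (auxPsi b x / max x 1) = auxPsi b x ∧ auxPsi b x / max x 1 ≤ auxPsi b x / b := by
  rcases le_or_gt x b with h | h
  · simp [auxPsi_zero h]
  · have := auxPsi_pos h
    rw [max_eq_left (by linarith)]
    have hx : 0 < x := by linarith
    refine ⟨by positivity, by field_simp, ?_⟩
    gcongr

/-- Let `K` be a nonnegative measure on `ℝ` with `∫ (|x|² ∧ 1) K(dx) < ∞` and
`K((n, ∞)) > 0` for every `n ≥ 1`.  Then for every `ε > 0` and every `N > 0` there exists
a continuous function `Y : ℝ → (0, ∞)` such that `∫ |Y − 1| dK ≤ ε`,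
`∫ (|x| ∧ x²) Y(x) K(dx) < ∞`, `∫ |x Y(x) − x 1_{|x| ≤ 1}| K(dx) < ∞`, and
`∫ (x Y(x) − x 1_{|x| ≤ 1}) K(dx) ≥ N`. -/
theorem stmt_15 (K : Measure ℝ)
    (hKint : ∫⁻ x, ENNReal.ofReal (min (x ^ 2) 1) ∂K ≠ ⊤)
    (htail : ∀ n : ℕ, 1 ≤ n → K (Ioi (n : ℝ)) ≠ 0)
    (ε N : ℝ) (hε : 0 < ε) (hN : 0 < N) :
    ∃ Y : ℝ → ℝ, Continuous Y ∧ (∀ x, 0 < Y x) ∧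
      (∫⁻ x, ENNReal.ofReal |Y x - 1| ∂K ≤ ENNReal.ofReal ε) ∧
      (∫⁻ x, ENNReal.ofReal (min |x| (x ^ 2) * Y x) ∂K ≠ ⊤) ∧
      (∫⁻ x, ENNReal.ofReal |x * Y x - (if |x| ≤ 1 then x else 0)| ∂K ≠ ⊤) ∧
      N ≤ ∫ x, (x * Y x - if |x| ≤ 1 then x else 0) ∂K := by
  have hmin : Integrable (fun x : ℝ => min (x ^ 2) 1) K := by
    refine ⟨(by fun_prop : Measurable _).aestronglyMeasurable, ?_⟩
    rw [hasFiniteIntegral_iff_ofReal (Filter.Eventually.of_forall fun x => by positivity)]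
    exact lt_top_iff_ne_top.2 hKint
  -- choice of a
  obtain ⟨a, ha, haε⟩ : ∃ a : ℝ, 1 ≤ a ∧ ∫ x, |a / max a |x| - 1| ∂K ≤ ε / 2 := by
    have hT : Filter.Tendsto (fun n : ℕ => ∫ x, |((n : ℝ) + 1) / max ((n : ℝ) + 1) |x| - 1| ∂K)
        Filter.atTop (nhds (∫ _x : ℝ, (0 : ℝ) ∂K)) := by
      refine tendsto_integral_of_dominated_convergence (fun x : ℝ => min (x ^ 2) 1) ?_ hmin ?_ ?_
      · intro n
        exact (by fun_prop : Measurable _).aestronglyMeasurable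
      · intro n
        refine Filter.Eventually.of_forall fun x => ?_
        have := aux_Y0_sub ((n : ℝ) + 1) (by linarith [n.cast_nonneg (α := ℝ)]) x
        simpa using this
      · refine Filter.Eventually.of_forall fun x => ?_
        obtain ⟨m, hm⟩ := exists_nat_ge |x|
        refine tendsto_const_nhds.congr' ?_
        filter_upwards [Filter.eventually_ge_atTop m] with n hn
        have hn' : (m : ℝ) ≤ n := by exact_mod_cast hn
        rw [(aux_Y0 ((n : ℝ) + 1) (by linarith [n.cast_nonneg (α := ℝ)]) x).2.2.1 (by linarith)]
        simp
    rw [integral_zero] at hT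
    obtain ⟨n, hn⟩ := (hT.eventually_lt_const (half_pos hε)).exists
    exact ⟨n + 1, by linarith [n.cast_nonneg (α := ℝ)], hn.le⟩
  have iY0 : Integrable (fun x : ℝ => |a / max a |x| - 1|) K :=
    (aux_int K hmin _ (by fun_prop) 1 (aux_Y0_sub a ha)).abs
  have ih : Integrable (fun x : ℝ => x * (a / max a |x|) - if |x| ≤ 1 then x else 0) K := by
    refine aux_int K hmin _ ?_ a fun x => ?_
    · refine Measurable.sub (by fun_prop) (Measurable.ite ?_ measurable_id measurable_const)
      exact measurableSet_le (by fun_prop) measurable_const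
    · obtain ⟨h1, h2, h3, h4⟩ := aux_Y0 a ha x
      rcases aux_min_cases x with ⟨h, e, -⟩ | ⟨h, e, -⟩
      · rw [h3 (by linarith), if_pos h, e]; simp; positivity
      · rw [if_neg (by linarith), e, sub_zero, abs_mul, abs_of_pos h1]; linarith
  set C0 := ∫ x, (x * (a / max a |x|) - if |x| ≤ 1 then x else 0) ∂K with hC0
  obtain ⟨n, hn⟩ := exists_nat_ge (2 * (N + |C0|) / ε)
  set N' := N + |C0| with hN'
  have hN'0 : 0 < N' := by positivity
  set b : ℝ := ((n + 1 : ℕ) : ℝ) with hb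
  have hb1 : 1 ≤ b := by rw [hb]; push_cast; linarith [n.cast_nonneg (α := ℝ)]
  have hbε : N' / b ≤ ε / 2 := by
    have : 2 * N' / ε ≤ b := by rw [hb]; push_cast; linarith
    rw [div_le_iff₀ hε] at this
    rw [div_le_iff₀ (by linarith)]
    linarith
  have iψ : Integrable (auxPsi b) K :=
    aux_int K hmin _ (auxPsi_cont b).measurable 1 (auxPsi_bd b hb1)
  have hm : 0 < ∫ x, auxPsi b x ∂K := by
    rw [integral_pos_iff_support_of_nonneg (auxPsi_nonneg b) iψ]
    refine lt_of_lt_of_le (pos_iff_ne_zero.2 (htail (n + 1) (by omega))) (measure_mono ?_)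
    intro x hx
    exact (auxPsi_pos hx).ne'
  set m := ∫ x, auxPsi b x ∂K with hmdef
  set c := N' / m with hc
  have hc0 : 0 < c := by positivity
  have hmax : ∀ x : ℝ, max x 1 ≠ 0 := fun x => (lt_of_lt_of_le one_pos (le_max_right _ _)).ne'
  have hmax' : ∀ x : ℝ, max a |x| ≠ 0 :=
    fun x => (lt_of_lt_of_le (by linarith : 0 < a) (le_max_left _ _)).ne'
  have hcont : Continuous (fun x => a / max a |x| + c * (auxPsi b x / max x 1)) := by
    refine Continuous.add (continuous_const.div (by fun_prop) hmax')
      (continuous_const.mul ((auxPsi_cont b).div (by fun_prop) hmax))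
  have heq : (fun x => x * (a / max a |x| + c * (auxPsi b x / max x 1)) -
      if |x| ≤ 1 then x else 0) =
      fun x => (x * (a / max a |x|) - if |x| ≤ 1 then x else 0) + c * auxPsi b x := by
    funext x
    linear_combination c * (aux_g b hb1 x).2.1
  have itot := ih.add (iψ.const_mul c)
  have fin : ∀ f : ℝ → ℝ, Integrable f K → ∫⁻ x, ENNReal.ofReal |f x| ∂K ≠ ⊤ := by
    intro f hf
    have := (hasFiniteIntegral_iff_norm f).1 hf.2
    exact this.ne
  refine ⟨fun x => a / max a |x| + c * (auxPsi b x / max x 1), hcont, ?_, ?_, ?_, ?_, ?_⟩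
  · intro x
    have := (aux_Y0 a ha x).1
    have := (aux_g b hb1 x).1
    positivity
  · have ib : Integrable (fun x => |a / max a |x| - 1| + c / b * auxPsi b x) K :=
      iY0.add (iψ.const_mul (c / b))
    calc _ ≤ ∫⁻ x, ENNReal.ofReal (|a / max a |x| - 1| + c / b * auxPsi b x) ∂K := by
          refine lintegral_mono fun x => ENNReal.ofReal_le_ofReal ?_
          obtain ⟨g1, g2, g3⟩ := aux_g b hb1 x
          have e1 : c * (auxPsi b x / max x 1) ≤ c / b * auxPsi b x := by
            calc _ ≤ c * (auxPsi b x / b) := by gcongr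
              _ = _ := by ring
          have e2 : 0 ≤ c * (auxPsi b x / max x 1) := by positivity
          calc _ = |(a / max a |x| - 1) + c * (auxPsi b x / max x 1)| := by congr 1; ring
            _ ≤ |a / max a |x| - 1| + |c * (auxPsi b x / max x 1)| := abs_add_le _ _
            _ ≤ _ := by rw [abs_of_nonneg e2]; linarith
      _ = ENNReal.ofReal (∫ x, (|a / max a |x| - 1| + c / b * auxPsi b x) ∂K) := by
          rw [ofReal_integral_eq_lintegral_ofReal ib]
          refine Filter.Eventually.of_forall fun x => ?_
          have := auxPsi_nonneg b x
          have : 0 < b := by linarith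
          simp only [Pi.zero_apply]
          positivity
      _ ≤ _ := by
          refine ENNReal.ofReal_le_ofReal ?_
          rw [integral_add iY0 (iψ.const_mul (c / b)), integral_const_mul, ← hmdef]
          have : c / b * m = N' / b := by rw [hc]; field_simp
          rw [this]; linarith
  · have i3 : Integrable (fun x => min |x| (x ^ 2) *
        (a / max a |x| + c * (auxPsi b x / max x 1))) K := by
      refine aux_int K hmin _ ((by fun_prop : Continuous fun x : ℝ => min |x| (x ^ 2)).mul
        hcont).measurable (a + c) fun x => ?_
      obtain ⟨h1, h2, h3, h4⟩ := aux_Y0 a ha x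
      obtain ⟨g1, g2, g3⟩ := aux_g b hb1 x
      have hYp : 0 ≤ a / max a |x| + c * (auxPsi b x / max x 1) := by positivity
      rw [abs_of_nonneg (mul_nonneg (by positivity) hYp)]
      rcases aux_min_cases x with ⟨h, e, e'⟩ | ⟨h, e, e'⟩
      · rw [e, e', h3 (by linarith), auxPsi_zero (by linarith [le_abs_self x])]
        simp only [zero_div, mul_zero, add_zero, mul_one]
        nlinarith [sq_nonneg x]
      · rw [e, e', mul_add]
        have : |x| * (c * (auxPsi b x / max x 1)) ≤ c := by
          calc _ = c * |x * (auxPsi b x / max x 1)| := by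
                rw [abs_mul, abs_of_nonneg g1]; ring
            _ = c * auxPsi b x := by rw [g2, abs_of_nonneg (auxPsi_nonneg b x)]
            _ ≤ c := mul_le_of_le_one_right hc0.le (auxPsi_le b x)
        linarith
    refine ne_top_of_le_ne_top (fin _ i3) (lintegral_mono fun x => ENNReal.ofReal_le_ofReal ?_)
    exact le_abs_self _
  · refine fin (fun x => x * (a / max a |x| + c * (auxPsi b x / max x 1)) -
      if |x| ≤ 1 then x else 0) ?_
    rw [heq]; exact itot
  · show N ≤ ∫ x, (fun x => x * (a / max a |x| + c * (auxPsi b x / max x 1)) -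
      if |x| ≤ 1 then x else 0) x ∂K
    rw [heq, integral_add ih (iψ.const_mul c), integral_const_mul, ← hmdef, ← hC0]
    have : c * m = N' := by rw [hc]; field_simp
    rw [this]
    linarith [neg_abs_le C0]
end
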